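/- Assume the Section 3 setup, and let u be the least nonnegative integer such that the tangent cone of F_{t-1} contains a monomial X^{2^u}Y^ℓ for some ℓ ≥ 0. Then the tangent cone of F_t equals Y^{2^u - 2} (with coefficient 1). -/

import Mathlib

open MvPolynomial

noncomputable section

/-- The smallest total degree of a monomial occurring in `P`. -/
def minMonomialDeg {K : Type*} [Field K] (P : MvPolynomial (Fin 2) K) : ℕ :=
  sInf {m : ℕ | ∃ s ∈ P.support, (s.sum fun _ e => e) = m}

/-- The tangent cone of `P` at the origin: the nonzero homogeneous component of
lowest total degree (for `P ≠ 0`). -/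
def tangentCone {K : Type*} [Field K] (P : MvPolynomial (Fin 2) K) : MvPolynomial (Fin 2) K :=
  homogeneousComponent (minMonomialDeg P) P

section Stepanov

variable {k S T E : Type*} [Field k] [CommRing S] [CommRing T] [Algebra k S] [Algebra k T]
  [AddCommGroup E] [Module k E] [FiniteDimensional k E]

lemma mul_eq_zero_of_pow_mul_eq_zero {c : S} (hc : ∀ z, c * z = 0 → z = 0) (n : ℕ) {z : S}
    (hz : c ^ n * z = 0) : z = 0 := by
  induction n with
  | zero => simpa using hz
  | succ n ih => exact ih (hc _ (by rw [← hz]; ring))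

/-- Sections with prescribed bidegree whose first `n` Taylor coefficients along the diagonal
vanish, together with the dimension bound obtained from one coefficient at a time. -/
theorem exists_submodule_taylor_vanishing (θ : S →ₐ[k] T) (x y x' y' : S)
    (hreg : ∀ z, (x' - x) * z = 0 → z = 0)
    (hker : ∀ z, θ z = 0 → ∃ w, (y' - y) * z = (x' - x) * w)
    (F : ℤ → ℤ → Submodule k S) (G : ℤ → Submodule k T)
    (hFmul : ∀ a b z, z ∈ F a b → (x * y' - y * x') * z ∈ F (a + 1) (b + 1))
    (hFdiv : ∀ a b z, (x' - x) * z ∈ F (a + 1) (b + 1) → z ∈ F a b)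
    (hθF : ∀ a b z, z ∈ F a b → θ z ∈ G (a + b))
    (hGdiv : ∀ N z, θ x * z ∈ G (N + 1) → z ∈ G N)
    (hGfin : ∀ N, FiniteDimensional k (G N))
    (a b : ℤ) (σ : E →ₗ[k] S) (hσ : ∀ v, σ v ∈ F a b) (n : ℕ) :
    ∃ W : Submodule k E,
      Module.finrank k E ≤ Module.finrank k W +
        ∑ j ∈ Finset.range n, Module.finrank k (G (a + b - j)) ∧
      ∀ v ∈ W, ∀ j ≤ n, ∃ z, (y' - y) ^ j * σ v = (x' - x) ^ j * z ∧ (j < n → θ z = 0) := by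
  induction n with
  | zero =>
    refine ⟨⊤, by simp, fun v _ j hj => ?_⟩
    obtain rfl : j = 0 := by omega
    exact ⟨σ v, by simp, by simp⟩
  | succ n ih =>
    obtain ⟨W, hdim, hW⟩ := ih
    have hreg' : ∀ z, (x' - x) ^ n * z = 0 → z = 0 :=
      fun z => mul_eq_zero_of_pow_mul_eq_zero hreg n
    have hZ : ∀ v : W, ∃ z, (y' - y) ^ n * σ v = (x' - x) ^ n * z := fun v =>
      (hW v v.2 n le_rfl).imp fun z hz => hz.1
    choose Z hZ using hZ
    have hmulF : ∀ (r : ℕ) z, z ∈ F a b → (x * y' - y * x') ^ r * z ∈ F (a + r) (b + r) := by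
      intro r z hz
      induction r with
      | zero => simpa using hz
      | succ r ihr =>
        have := hFmul _ _ _ ihr
        rw [← mul_assoc, ← pow_succ'] at this
        push_cast
        simpa [add_assoc] using this
    have hdivF : ∀ (r : ℕ) z, (x' - x) ^ r * z ∈ F (a + r) (b + r) → z ∈ F a b := by
      intro r
      induction r with
      | zero => intro z hz; simpa using hz
      | succ r ihr =>
        intro z hz
        refine ihr z (hFdiv _ _ _ ?_)
        rw [← mul_assoc, ← pow_succ']
        push_cast at hz
        simpa [add_assoc] using hz
    have hdivG : ∀ (r : ℕ) (N : ℤ) z, θ x ^ r * z ∈ G N → z ∈ G (N - r) := by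
      intro r
      induction r with
      | zero => intro N z hz; simpa using hz
      | succ r ihr =>
        intro N z hz
        have h1 := ihr N (θ x * z) (by rw [← mul_assoc, ← pow_succ]; exact hz)
        refine hGdiv _ _ ?_
        push_cast
        rwa [show N - ((r : ℤ) + 1) + 1 = N - r by ring]
    have hmem : ∀ v : W, θ (Z v) ∈ G (a + b - n) := by
      intro v
      choose! Zj hZj hZj0 using hW v v.2
      have hZn : Zj n = Z v := by
        have := (hZj n le_rfl).symm.trans (hZ v)
        rw [← sub_eq_zero, ← mul_sub] at this
        exact sub_eq_zero.1 (hreg' _ this)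
      set Z'' : S := ∑ j ∈ Finset.range (n + 1), x ^ j * (-y) ^ (n - j) * (n.choose j : S) * Zj j
        with hZ''
      have hexp : (x * y' - y * x') ^ n * σ v = (x' - x) ^ n * Z'' := by
        rw [show x * y' - y * x' = x * (y' - y) + (-y) * (x' - x) by ring, add_pow,
          Finset.sum_mul, hZ'', Finset.mul_sum]
        refine Finset.sum_congr rfl fun j hj => ?_
        have hjn : j ≤ n := by simpa [Nat.lt_succ_iff] using hj
        have h1 := hZj j hjn
        calc (x * (y' - y)) ^ j * (-y * (x' - x)) ^ (n - j) * (n.choose j : S) * σ v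
            = x ^ j * (-y) ^ (n - j) * (x' - x) ^ (n - j) * (n.choose j : S) *
              ((y' - y) ^ j * σ v) := by rw [mul_pow, mul_pow]; ring
          _ = x ^ j * (-y) ^ (n - j) * (x' - x) ^ (n - j) * (n.choose j : S) *
              ((x' - x) ^ j * Zj j) := by rw [h1]
          _ = ((x' - x) ^ (n - j) * (x' - x) ^ j) *
              (x ^ j * (-y) ^ (n - j) * (n.choose j : S) * Zj j) := by ring
          _ = _ := by rw [← pow_add, Nat.sub_add_cancel hjn]
      have h1 : Z'' ∈ F a b := hdivF n _ (hexp ▸ hmulF n _ (hσ v))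
      have h2 : θ Z'' = θ x ^ n * θ (Z v) := by
        rw [hZ'', map_sum, Finset.sum_range_succ, Finset.sum_eq_zero, hZn]
        · simp
        · intro j hj
          have hjn : j < n := by simpa using hj
          rw [map_mul, hZj0 j hjn.le hjn, mul_zero]
      exact hdivG n _ _ (h2 ▸ hθF _ _ _ h1)
    let L : W →ₗ[k] G (a + b - n) :=
      { toFun := fun v => ⟨θ (Z v), hmem v⟩
        map_add' := fun v w => by
          have : Z (v + w) = Z v + Z w := by
            refine sub_eq_zero.1 (hreg' _ ?_)
            rw [mul_sub, mul_add, ← hZ, ← hZ, ← hZ, Submodule.coe_add, map_add]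
            ring
          ext
          simp [this]
        map_smul' := fun c v => by
          have : Z (c • v) = c • Z v := by
            refine sub_eq_zero.1 (hreg' _ ?_)
            rw [mul_sub, mul_smul_comm, ← hZ, ← hZ, Submodule.coe_smul, map_smul, mul_smul_comm,
              sub_self]
          ext
          simp [this] }
    refine ⟨(LinearMap.ker L).map W.subtype, ?_, ?_⟩
    · have h1 := L.finrank_range_add_finrank_ker
      have h2 : Module.finrank k (LinearMap.range L) ≤ Module.finrank k (G (a + b - n)) :=
        Submodule.finrank_le _
      have h3 : Module.finrank k ((LinearMap.ker L).map W.subtype) =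
          Module.finrank k (LinearMap.ker L) :=
        Submodule.finrank_map_subtype_eq _ _
      rw [Finset.sum_range_succ, h3]
      omega
    · rintro _ ⟨v, hv, rfl⟩ j hj
      have hv0 : θ (Z v) = 0 := by
        have : L v = 0 := hv
        simpa [L] using congrArg Subtype.val this
      rcases Nat.lt_or_ge n j with hlt | hle
      · obtain rfl : j = n + 1 := by omega
        obtain ⟨w, hw⟩ := hker _ hv0
        refine ⟨w, ?_, fun h => absurd h (lt_irrefl _)⟩
        rw [pow_succ', mul_assoc, Submodule.subtype_apply, hZ v,
          show (y' - y) * ((x' - x) ^ n * Z v) = (x' - x) ^ n * ((y' - y) * Z v) by ring, hw]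
        ring
      · rcases hle.lt_or_eq with hlt | rfl
        · obtain ⟨z, hz, hz0⟩ := hW v v.2 j hle
          exact ⟨z, hz, fun _ => hz0 hlt⟩
        · exact ⟨Z v, hZ v, fun _ => hv0⟩

end Stepanov

namespace Polynomial

variable {k T : Type*} [Field k] [CommRing T] [Algebra k T]

/-- A multiplicative increasing filtration of an algebra by subspaces. -/
structure IsMulFiltration (F : ℤ → Submodule k T) : Prop where
  mono : Monotone F
  one_mem : 1 ∈ F 0
  mul_mem : ∀ {a b : ℤ} {x y : T}, x ∈ F a → y ∈ F b → x * y ∈ F (a + b)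

/-- The trivial filtration, concentrated in degree zero. -/
def trivFiltration (k T : Type*) [Field k] [CommRing T] [Algebra k T] (N : ℤ) : Submodule k T :=
  if 0 ≤ N then ⊤ else ⊥

lemma isMulFiltration_triv : IsMulFiltration (trivFiltration k T) where
  mono a b hab := by
    unfold trivFiltration
    split_ifs <;> first | exact le_rfl | exact bot_le | omega
  one_mem := by simp [trivFiltration]
  mul_mem {a b x y} hx hy := by
    unfold trivFiltration at *
    split_ifs at * <;> simp_all
    omega

/-- The filtration on `T[X]` for which `X` has weight `w`. -/
def coeffFiltration (F : ℤ → Submodule k T) (w : ℕ) (N : ℤ) : Submodule k T[X] where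
  carrier := {p | ∀ i : ℕ, p.coeff i ∈ F (N - w * i)}
  add_mem' hp hq i := by simpa using add_mem (hp i) (hq i)
  zero_mem' i := by simp
  smul_mem' c p hp i := by simpa using (F _).smul_mem c (hp i)

variable {F : ℤ → Submodule k T} {w : ℕ}

lemma monomial_mem_coeffFiltration {N : ℤ} {a : T} {n : ℕ}
    (ha : a ∈ F (N - w * n)) : monomial n a ∈ coeffFiltration F w N := by
  intro i
  rw [coeff_monomial]
  split_ifs with h
  · rwa [← h]
  · exact zero_mem _

lemma IsMulFiltration.coeffFiltration (hF : IsMulFiltration F) (w : ℕ) :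
    IsMulFiltration (coeffFiltration F w) where
  mono a b hab p hp i := hF.mono (by omega) (hp i)
  one_mem := by
    rw [← monomial_zero_one]
    exact monomial_mem_coeffFiltration (by simpa using hF.one_mem)
  mul_mem {a b p q} hp hq i := by
    rw [coeff_mul]
    refine Submodule.sum_mem _ fun ij hij => ?_
    rw [Finset.HasAntidiagonal.mem_antidiagonal] at hij
    have := hF.mul_mem (hp ij.1) (hq ij.2)
    rwa [show a - (w : ℤ) * ij.1 + (b - w * ij.2) = a + b - w * i by
      rw [← hij]; push_cast; ring] at this

lemma C_mem_coeffFiltration {N : ℤ} {a : T} (ha : a ∈ F N) :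
    C a ∈ Polynomial.coeffFiltration F w N := by
  rw [← monomial_zero_left]
  exact monomial_mem_coeffFiltration (by simpa using ha)

lemma IsMulFiltration.X_mem (hF : IsMulFiltration F) :
    (X : T[X]) ∈ Polynomial.coeffFiltration F w w :=
  monomial_mem_coeffFiltration (by simpa using hF.one_mem)

lemma IsMulFiltration.pow_mem (hF : IsMulFiltration F) {a : ℤ} {x : T} (hx : x ∈ F a) (n : ℕ) :
    x ^ n ∈ F (n * a) := by
  induction n with
  | zero => simpa using hF.one_mem
  | succ n ih =>
    have := hF.mul_mem ih hx
    rw [pow_succ]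
    push_cast
    rwa [add_mul, one_mul]

lemma IsMulFiltration.modByMonic_mem (hF : IsMulFiltration F) {g : T[X]} (hg : g.Monic)
    (hgF : g ∈ Polynomial.coeffFiltration F w (w * g.natDegree)) {N : ℤ} :
    ∀ {p : T[X]}, p ∈ Polynomial.coeffFiltration F w N →
      p %ₘ g ∈ Polynomial.coeffFiltration F w N := by
  intro p
  induction hn : p.natDegree using Nat.strong_induction_on generalizing p with
  | _ n ih =>
  intro hp
  rcases subsingleton_or_nontrivial T with hT | hT
  · rw [Subsingleton.elim (p %ₘ g) p]
    exact hp
  by_cases hlt : p.degree < g.degree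
  · rwa [(modByMonic_eq_self_iff hg).2 hlt]
  have hle : g.natDegree ≤ p.natDegree := natDegree_le_natDegree (not_lt.1 hlt)
  have hp0 : p ≠ 0 := by
    rintro rfl
    exact hlt (by simpa using bot_lt_iff_ne_bot.2 (degree_ne_bot.2 hg.ne_zero))
  set z := C (leadingCoeff p) * X ^ (natDegree p - natDegree g) with hz
  have hmod : (p - g * z) %ₘ g = p %ₘ g := by
    rw [sub_modByMonic, (modByMonic_eq_zero_iff_dvd hg).2 (dvd_mul_right g z), sub_zero]
  have hmem : p - g * z ∈ Polynomial.coeffFiltration F w N := by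
    refine sub_mem hp ?_
    have h1 : z ∈ Polynomial.coeffFiltration F w (N - w * g.natDegree) := by
      rw [hz, C_mul_X_pow_eq_monomial]
      refine monomial_mem_coeffFiltration ?_
      have := hp p.natDegree
      rwa [Nat.cast_sub hle, show N - (w : ℤ) * g.natDegree - w * (p.natDegree - g.natDegree) =
        N - w * p.natDegree by ring]
    simpa using (hF.coeffFiltration w).mul_mem hgF h1
  have hdeg := div_wf_lemma ⟨not_lt.1 hlt, hp0⟩ hg
  rw [← hmod]
  by_cases h0 : p - g * z = 0
  · rw [h0, zero_modByMonic]
    exact zero_mem _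
  · exact ih _ (hn ▸ natDegree_lt_natDegree h0 hdeg) rfl hmem

/-- The filtration induced on `T[X]/(g)` through the reduced representatives. -/
def adjoinFiltration {g : T[X]} (hg : g.Monic) (F : ℤ → Submodule k T) (w : ℕ) (N : ℤ) :
    Submodule k (AdjoinRoot g) where
  carrier := {z | AdjoinRoot.modByMonicHom hg z ∈ coeffFiltration F w N}
  add_mem' hx hy := by
    simpa using add_mem (show AdjoinRoot.modByMonicHom hg _ ∈ coeffFiltration F w N from hx) hy
  zero_mem' := by simp
  smul_mem' c x hx := by
    have h : AdjoinRoot.modByMonicHom hg (c • x) = c • AdjoinRoot.modByMonicHom hg x := by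
      rw [← algebraMap_smul T c x, map_smul, algebraMap_smul]
    simpa [h] using (coeffFiltration F w N).smul_mem c hx

variable {g : T[X]} (hg : g.Monic)

lemma mem_adjoinFiltration {N : ℤ} {z : AdjoinRoot g} :
    z ∈ adjoinFiltration hg F w N ↔
      AdjoinRoot.modByMonicHom hg z ∈ coeffFiltration F w N := Iff.rfl

lemma IsMulFiltration.mk_mem (hF : IsMulFiltration F)
    (hgF : g ∈ Polynomial.coeffFiltration F w (w * g.natDegree)) {N : ℤ} {p : T[X]}
    (hp : p ∈ Polynomial.coeffFiltration F w N) :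
    AdjoinRoot.mk g p ∈ Polynomial.adjoinFiltration hg F w N := by
  rw [mem_adjoinFiltration, AdjoinRoot.modByMonicHom_mk]
  exact hF.modByMonic_mem hg hgF hp

lemma IsMulFiltration.adjoinFiltration (hF : IsMulFiltration F)
    (hgF : g ∈ Polynomial.coeffFiltration F w (w * g.natDegree)) :
    IsMulFiltration (adjoinFiltration hg F w) where
  mono a b hab z hz := (hF.coeffFiltration w).mono hab hz
  one_mem := by
    rw [← map_one (AdjoinRoot.mk g)]
    exact hF.mk_mem hg hgF (hF.coeffFiltration w).one_mem
  mul_mem {a b x y} hx hy := by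
    rw [← AdjoinRoot.mk_leftInverse hg x, ← AdjoinRoot.mk_leftInverse hg y, ← map_mul]
    exact hF.mk_mem hg hgF ((hF.coeffFiltration w).mul_mem hx hy)

lemma IsMulFiltration.of_mem (hF : IsMulFiltration F)
    (hgF : g ∈ Polynomial.coeffFiltration F w (w * g.natDegree)) {N : ℤ} {a : T} (ha : a ∈ F N) :
    AdjoinRoot.of g a ∈ Polynomial.adjoinFiltration hg F w N :=
  hF.mk_mem hg hgF (C_mem_coeffFiltration ha)

lemma IsMulFiltration.root_mem (hF : IsMulFiltration F)
    (hgF : g ∈ Polynomial.coeffFiltration F w (w * g.natDegree)) :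
    AdjoinRoot.root g ∈ Polynomial.adjoinFiltration hg F w w :=
  hF.mk_mem hg hgF hF.X_mem

lemma modByMonicHom_of_mul (s : T) (z : AdjoinRoot g) :
    AdjoinRoot.modByMonicHom hg (AdjoinRoot.of g s * z) = s • AdjoinRoot.modByMonicHom hg z := by
  rw [← map_smul, Algebra.smul_def]
  rfl

lemma mem_coeffFiltration_of_smul {s : T} {e : ℤ} (hs : ∀ N z, s * z ∈ F (N + e) → z ∈ F N)
    {N : ℤ} {p : T[X]} (hp : s • p ∈ coeffFiltration F w (N + e)) :
    p ∈ coeffFiltration F w N := by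
  intro i
  refine hs _ _ ?_
  have := hp i
  rw [coeff_smul, smul_eq_mul] at this
  rwa [show N - (w : ℤ) * i + e = N + e - w * i by ring]

lemma mem_adjoinFiltration_of_mul {s : T} {e : ℤ} (hs : ∀ N z, s * z ∈ F (N + e) → z ∈ F N)
    {N : ℤ} {z : AdjoinRoot g} (hz : AdjoinRoot.of g s * z ∈ adjoinFiltration hg F w (N + e)) :
    z ∈ adjoinFiltration hg F w N := by
  rw [mem_adjoinFiltration, modByMonicHom_of_mul] at hz
  exact mem_coeffFiltration_of_smul hs hz

/-- Division by `X - a` preserves the weight-zero filtration. -/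
lemma mem_coeffFiltration_of_X_sub_C_mul (hF : IsMulFiltration F) {a : T}
    {N : ℤ} {p : T[X]}
    (hp : (X - C a) * p ∈ coeffFiltration F 0 (N + 1))
    (hreg : ∀ N z, a * z ∈ F (N + 1) → z ∈ F N) : p ∈ coeffFiltration F 0 N := by
  intro i
  simp only [Nat.cast_zero, zero_mul, sub_zero]
  induction i with
  | zero =>
    have := hp 0
    simp only [sub_mul, coeff_sub, coeff_C_mul, Nat.cast_zero, zero_mul, sub_zero,
      coeff_X_mul_zero, zero_sub, neg_mem_iff] at this
    exact hreg _ _ this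
  | succ i ih =>
    have := hp (i + 1)
    simp only [sub_mul, coeff_sub, coeff_C_mul, Nat.cast_zero, zero_mul, sub_zero,
      coeff_X_mul] at this
    refine hreg _ _ ?_
    have h1 : p.coeff i ∈ F (N + 1) := hF.mono (by omega) ih
    simpa using sub_mem h1 this

/-- Division by `X - a` lowers the degree by one. -/
lemma mem_coeffFiltration_triv_of_X_sub_C_mul {a : T} {N : ℤ} {p : T[X]}
    (hp : (X - C a) * p ∈ coeffFiltration (trivFiltration k T) 1 (N + 1)) :
    p ∈ coeffFiltration (trivFiltration k T) 1 N := by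
  intro i
  unfold trivFiltration
  split_ifs with h
  · trivial
  rw [Submodule.mem_bot]
  by_contra hi
  have hp0 : p ≠ 0 := by rintro rfl; simp at hi
  have hc : ((X - C a) * p).coeff (p.natDegree + 1) = p.leadingCoeff := by
    simp [sub_mul, coeff_X_mul]
  have h1 := hp (p.natDegree + 1)
  have h2 : i ≤ p.natDegree := le_natDegree_of_ne_zero hi
  rw [hc, trivFiltration, if_neg (by push_cast at *; omega), Submodule.mem_bot] at h1
  exact hp0 (leadingCoeff_eq_zero.1 h1)

lemma finiteDimensional_adjoinFiltration (hF : IsMulFiltration F) {N : ℤ}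
    [FiniteDimensional k (F N)] :
    FiniteDimensional k (adjoinFiltration hg F w N) ∧
      Module.finrank k (adjoinFiltration hg F w N) ≤ g.natDegree * Module.finrank k (F N) := by
  let L : adjoinFiltration hg F w N →ₗ[k] (Fin g.natDegree → F N) :=
    { toFun := fun z i => ⟨(AdjoinRoot.modByMonicHom hg z.1).coeff i,
        hF.mono (by have : 0 ≤ (w : ℤ) * (i : ℕ) := by positivity
                    omega) (z.2 i)⟩
      map_add' := fun x y => by ext i; simp
      map_smul' := fun c x => by
        have h : AdjoinRoot.modByMonicHom hg (c • x.1) = c • AdjoinRoot.modByMonicHom hg x.1 := by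
          rw [← algebraMap_smul T c x.1, map_smul, algebraMap_smul]
        ext i; simp [h] }
  have hL : Function.Injective L := by
    rw [injective_iff_map_eq_zero]
    intro z hz
    have h0 : AdjoinRoot.modByMonicHom hg z.1 = 0 := by
      ext i
      rcases lt_or_ge i g.natDegree with h | h
      · simpa [L] using congrArg Subtype.val (congrFun hz ⟨i, h⟩)
      · rw [← AdjoinRoot.mk_leftInverse hg z.1, AdjoinRoot.modByMonicHom_mk]
        rcases subsingleton_or_nontrivial T with hT | hT
        · exact Subsingleton.elim _ _
        · rw [coeff_zero]
          refine coeff_eq_zero_of_degree_lt ((degree_modByMonic_lt _ hg).trans_le ?_)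
          rw [degree_eq_natDegree hg.ne_zero]
          exact_mod_cast h
    ext
    rw [← AdjoinRoot.mk_leftInverse hg z.1, h0]
    simp
  refine ⟨Module.Finite.of_injective L hL, ?_⟩
  simpa [Module.finrank_pi_fintype] using LinearMap.finrank_le_finrank_of_injective hL

lemma finiteDimensional_coeffFiltration_triv (N : ℤ) :
    FiniteDimensional k (coeffFiltration (trivFiltration k k) 1 N) ∧
      Module.finrank k (coeffFiltration (trivFiltration k k) 1 N) ≤ (N + 1).toNat := by
  let L : coeffFiltration (trivFiltration k k) 1 N →ₗ[k] (Fin (N + 1).toNat → k) :=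
    { toFun := fun z i => z.1.coeff i
      map_add' := fun x y => by ext i; simp
      map_smul' := fun c x => by ext i; simp }
  have hL : Function.Injective L := by
    rw [injective_iff_map_eq_zero]
    intro z hz
    ext i
    rcases lt_or_ge i (N + 1).toNat with h | h
    · simpa [L] using congrFun hz ⟨i, h⟩
    · have := z.2 i
      rw [trivFiltration, if_neg (by push_cast; omega), Submodule.mem_bot] at this
      simpa using this
  refine ⟨Module.Finite.of_injective L hL, ?_⟩
  simpa using LinearMap.finrank_le_finrank_of_injective hL

end Polynomial

namespace Polynomial

variable {k R E : Type*} [Field k] [CommRing R] [Algebra k R]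
  [AddCommGroup E] [Module k E] [FiniteDimensional k E]

/-- The filtration of `k[X]` by degree. -/
abbrev degreeFiltration (k : Type*) [Field k] : ℤ → Submodule k k[X] :=
  coeffFiltration (trivFiltration k k) 1

lemma coeff_eq_zero_of_mem_triv {T : Type*} [CommRing T] [Algebra k T] {N : ℤ} {p : T[X]}
    (hp : p ∈ coeffFiltration (trivFiltration k T) 1 N) {i : ℕ} (hi : N < i) : p.coeff i = 0 := by
  have := hp i
  rwa [trivFiltration, if_neg (by push_cast; omega), Submodule.mem_bot] at this

lemma mem_coeffFiltration_triv {T : Type*} [CommRing T] [Algebra k T] {N : ℤ} {p : T[X]}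
    (h : ∀ i : ℕ, N < i → p.coeff i = 0) : p ∈ coeffFiltration (trivFiltration k T) 1 N := by
  intro i
  unfold trivFiltration
  split_ifs with hi
  · trivial
  · rw [Submodule.mem_bot]
    exact h i (by push_cast at hi; omega)

variable {F : ℤ → Submodule k R}

lemma IsMulFiltration.algebraMap_mem (hF : IsMulFiltration F) (c : k) :
    algebraMap k R c ∈ F 0 := by
  rw [Algebra.algebraMap_eq_smul_one]
  exact (F 0).smul_mem c hF.one_mem

lemma IsMulFiltration.aeval_mem (hF : IsMulFiltration F) {x : R} (hx : x ∈ F 1) {N : ℤ} {p : k[X]}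
    (hp : p ∈ degreeFiltration k N) : aeval x p ∈ F N := by
  rw [aeval_eq_sum_range]
  refine Submodule.sum_mem _ fun i _ => ?_
  rcases lt_or_ge N (i : ℤ) with h | h
  · rw [coeff_eq_zero_of_mem_triv hp h, zero_smul]
    exact zero_mem _
  · exact (F N).smul_mem _ (hF.mono (by simpa using h) (hF.pow_mem hx i))

/-- The curve equation with the constants extended to `R[X]`. -/
abbrev mapBase (R : Type*) [CommRing R] [Algebra k R] (φ : k[X][X]) : R[X][X] :=
  φ.map (mapRingHom (algebraMap k R))

/-- The curve equation with its first variable specialised. -/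
abbrev specFst (x : R) (φ : k[X][X]) : R[X] := φ.map (aeval x : k[X] →ₐ[k] R).toRingHom

/-- Restriction of functions on the product of two curves to the diagonal. -/
def diagonalHom (x : R) (φ : k[X][X]) (ψ : R[X]) (h : ψ ∣ specFst x φ) :
    AdjoinRoot (mapBase R φ) →ₐ[k] AdjoinRoot ψ :=
  AdjoinRoot.liftAlgHom _ ((AdjoinRoot.ofAlgHom k ψ).comp ((aeval x).restrictScalars k))
    (AdjoinRoot.root ψ) (by
      rw [mapBase, eval₂_map]
      have h1 : (((AdjoinRoot.ofAlgHom k ψ).comp ((aeval x).restrictScalars k) :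
          R[X] →ₐ[k] AdjoinRoot ψ) : R[X] →+* AdjoinRoot ψ).comp (mapRingHom (algebraMap k R)) =
          (AdjoinRoot.of ψ).comp (aeval x : k[X] →ₐ[k] R).toRingHom := by
        ext c
        · simp
        · simp
      rw [h1, ← eval₂_map]
      obtain ⟨r, hr⟩ := h
      rw [show φ.map (aeval x : k[X] →ₐ[k] R).toRingHom = ψ * r from hr, eval₂_mul,
        AdjoinRoot.eval₂_root, zero_mul])

lemma diagonalHom_mk (x : R) (φ : k[X][X]) (ψ : R[X]) (h : ψ ∣ specFst x φ) (p : R[X][X]) :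
    diagonalHom x φ ψ h (AdjoinRoot.mk _ p) = AdjoinRoot.mk ψ (p.map (evalRingHom x)) := by
  rw [diagonalHom, AdjoinRoot.liftAlgHom_mk, ← AdjoinRoot.aeval_eq, aeval_def, eval₂_map]
  congr 1

lemma mem_coeffFiltration_of_X_sub_C_mul_eq (hF : IsMulFiltration F) {y : R} (hy : y ∈ F 1)
    {p ψ : R[X]} {N : ℤ} (hp : p ∈ coeffFiltration F 1 (N + 1)) (h : p = (X - C y) * ψ) :
    ψ ∈ coeffFiltration F 1 N := by
  have key : ∀ j i : ℕ, ψ.natDegree < i + j → ψ.coeff i ∈ F (N - (1 : ℕ) * i) := by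
    intro j
    induction j with
    | zero => intro i hi; rw [coeff_eq_zero_of_natDegree_lt (by simpa using hi)]; exact zero_mem _
    | succ j ih =>
      intro i hi
      have h1 : ψ.coeff i = p.coeff (i + 1) + y * ψ.coeff (i + 1) := by
        rw [h]; simp [sub_mul, coeff_X_mul]
      rw [h1]
      refine add_mem ?_ ?_
      · have := hp (i + 1)
        rwa [show N + 1 - ((1 : ℕ) : ℤ) * ((i + 1 : ℕ) : ℤ) = N - (1 : ℕ) * i by
          push_cast; ring] at this
      · have := hF.mul_mem hy (ih (i + 1) (by omega))
        rwa [show 1 + (N - ((1 : ℕ) : ℤ) * ((i + 1 : ℕ) : ℤ)) = N - (1 : ℕ) * i by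
          push_cast; ring] at this
  exact fun i => key (ψ.natDegree + 1) i (by omega)

lemma adjoinRoot_of_mul_eq_zero {g : R[X]} (hg : g.Monic) {s : R} (hs : ∀ r, s * r = 0 → r = 0)
    {z : AdjoinRoot g} (hz : AdjoinRoot.of g s * z = 0) : z = 0 := by
  have h1 : s • AdjoinRoot.modByMonicHom hg z = 0 := by
    rw [← modByMonicHom_of_mul, hz, map_zero]
  have h2 : AdjoinRoot.modByMonicHom hg z = 0 := by
    ext i
    refine hs _ ?_
    simpa using congrArg (coeff · i) h1
  rw [← AdjoinRoot.mk_leftInverse hg z, h2, map_zero]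

lemma diagonalHom_kernel (x y : R) (φ : k[X][X]) (ψ : R[X])
    (h : specFst x φ = (X - C y) * ψ) (z : AdjoinRoot (mapBase R φ))
    (hz : diagonalHom x φ ψ (h ▸ dvd_mul_left _ _) z = 0) :
    ∃ w, (AdjoinRoot.root (mapBase R φ) - AdjoinRoot.of (mapBase R φ) (C y)) * z =
      (AdjoinRoot.of (mapBase R φ) X - AdjoinRoot.of (mapBase R φ) (C x)) * w := by
  obtain ⟨p, rfl⟩ := AdjoinRoot.mk_surjective z
  rw [diagonalHom_mk, AdjoinRoot.mk_eq_zero] at hz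
  obtain ⟨r, hr⟩ := hz
  have hdvd : ∀ q : R[X][X], C (X - C x) ∣ q - (q.map (evalRingHom x)).map C := by
    intro q
    rw [C_dvd_iff_dvd_coeff]
    intro i
    simpa using X_sub_C_dvd_sub_C_eval (p := q.coeff i) (a := x)
  obtain ⟨p₁, hp₁⟩ := hdvd p
  obtain ⟨e, he⟩ := hdvd (mapBase R φ)
  have hφ : (mapBase R φ).map (evalRingHom x) = specFst x φ := by
    rw [mapBase, specFst, map_map]
    congr 1
    ext <;> simp
  rw [hφ, h] at he
  refine ⟨AdjoinRoot.mk _ ((X - C (C y)) * p₁ - e * r.map C), ?_⟩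
  rw [← AdjoinRoot.mk_X, ← AdjoinRoot.mk_C, ← AdjoinRoot.mk_C, ← AdjoinRoot.mk_C, ← map_sub,
    ← map_sub, ← map_mul, ← map_mul, AdjoinRoot.mk_eq_mk]
  refine ⟨r.map C, ?_⟩
  rw [hr] at hp₁
  rw [← C_sub]
  simp only [Polynomial.map_mul, Polynomial.map_sub, map_X, map_C] at hp₁ he
  linear_combination (X - C (C y)) * hp₁ - he * r.map C

lemma mapBase_mem_coeffFiltration_left (hF : IsMulFiltration F) (φ : k[X][X]) :
    mapBase R φ ∈ coeffFiltration (coeffFiltration F 0) 0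
      ((0 : ℕ) * (mapBase R φ).natDegree : ℤ) := by
  intro i j
  simpa using hF.algebraMap_mem _

lemma mapBase_mem_coeffFiltration_right {φ : k[X][X]} (hφ : φ.Monic)
    (hφF : φ ∈ coeffFiltration (degreeFiltration k) 1 φ.natDegree) :
    mapBase R φ ∈ coeffFiltration (coeffFiltration (trivFiltration k R) 1) 1
      ((1 : ℕ) * (mapBase R φ).natDegree : ℤ) := by
  rcases subsingleton_or_nontrivial R with h | h
  · rw [Subsingleton.elim (mapBase R φ) 0]
    exact zero_mem _
  intro i
  refine mem_coeffFiltration_triv fun j hj => ?_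
  rw [mapBase, hφ.natDegree_map] at hj
  rw [mapBase, coeff_map, coe_mapRingHom, coeff_map, coeff_eq_zero_of_mem_triv (hφF i) (by
    push_cast at hj ⊢; linarith), map_zero]

/-- The Taylor vanishing theorem on the product of a plane curve with itself. -/
theorem exists_submodule_taylor_vanishing_curve (hF : IsMulFiltration F) {x y : R}
    (hx : x ∈ F 1) (hy : y ∈ F 1) (hreg : ∀ N z, x * z ∈ F (N + 1) → z ∈ F N)
    {φ : k[X][X]} (hφ : φ.Monic) (hφF : φ ∈ coeffFiltration (degreeFiltration k) 1 φ.natDegree)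
    {ψ : R[X]} (hψ : ψ.Monic) (hφψ : specFst x φ = (X - C y) * ψ)
    (hψF : ψ ∈ coeffFiltration F 1 ψ.natDegree)
    (hfin : ∀ N, FiniteDimensional k (F N)) (a b : ℤ)
    (σ : E →ₗ[k] AdjoinRoot (mapBase R φ))
    (hσ₁ : ∀ v, σ v ∈ adjoinFiltration (hφ.map (mapRingHom (algebraMap k R)))
      (coeffFiltration F 0) 0 a)
    (hσ₂ : ∀ v, σ v ∈ adjoinFiltration (hφ.map (mapRingHom (algebraMap k R)))
      (coeffFiltration (trivFiltration k R) 1) 1 b) (n : ℕ) :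
    ∃ W : Submodule k E,
      Module.finrank k E ≤ Module.finrank k W +
        ∑ j ∈ Finset.range n, ψ.natDegree * Module.finrank k (F (a + b - j)) ∧
      ∀ v ∈ W, ∃ z, (AdjoinRoot.root (mapBase R φ) - AdjoinRoot.of (mapBase R φ) (C y)) ^ n * σ v =
        (AdjoinRoot.of (mapBase R φ) X - AdjoinRoot.of (mapBase R φ) (C x)) ^ n * z := by
  have hS := hφ.map (mapRingHom (algebraMap k R))
  have hT : IsMulFiltration (trivFiltration k R) := isMulFiltration_triv
  have hF₁ : IsMulFiltration (coeffFiltration F 0) := hF.coeffFiltration 0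
  have hF₂ : IsMulFiltration (coeffFiltration (trivFiltration k R) 1) := hT.coeffFiltration 1
  have hS₁ := mapBase_mem_coeffFiltration_left hF φ
  have hS₂ := mapBase_mem_coeffFiltration_right (R := R) hφ hφF
  have hψF' : ψ ∈ coeffFiltration F 1 ((1 : ℕ) * ψ.natDegree : ℤ) := by simpa using hψF
  have hG := hF.adjoinFiltration hψ hψF'
  have hA₁ := hF₁.adjoinFiltration hS hS₁
  have hA₂ := hF₂.adjoinFiltration hS hS₂
  set θ := diagonalHom x φ ψ (hφψ ▸ dvd_mul_left _ _) with hθ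
  have hθof : ∀ p : R[X], θ (AdjoinRoot.of _ p) = AdjoinRoot.of ψ (p.eval x) := by
    intro p
    rw [hθ, ← AdjoinRoot.mk_C, diagonalHom_mk]
    simp
  obtain ⟨W, hW, hWz⟩ := exists_submodule_taylor_vanishing θ
    (AdjoinRoot.of (mapBase R φ) (C x)) (AdjoinRoot.of _ (C y)) (AdjoinRoot.of _ X)
    (AdjoinRoot.root _)
    (fun z hz => adjoinRoot_of_mul_eq_zero hS (s := X - C x)
      (fun r hr => (monic_X_sub_C x).mul_right_eq_zero_iff.1 hr) (by rwa [map_sub]))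
    (fun z hz => diagonalHom_kernel x y φ ψ hφψ z hz)
    (fun a b => adjoinFiltration hS (coeffFiltration F 0) 0 a ⊓
      adjoinFiltration hS (coeffFiltration (trivFiltration k R) 1) 1 b)
    (adjoinFiltration hψ F 1)
    (by
      rintro a b z ⟨hz₁, hz₂⟩
      refine ⟨?_, ?_⟩
      · rw [add_comm]
        refine hA₁.mul_mem (sub_mem ?_ ?_) hz₁
        · simpa using hA₁.mul_mem (hF₁.of_mem hS hS₁ (C_mem_coeffFiltration hx))
            (hF₁.root_mem hS hS₁)
        · simpa using hA₁.mul_mem (hF₁.of_mem hS hS₁ (C_mem_coeffFiltration hy))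
            (hF₁.of_mem hS hS₁ hF.X_mem)
      · rw [add_comm]
        have h0 : ∀ r : R, C r ∈ coeffFiltration (trivFiltration k R) 1 0 := fun r =>
          C_mem_coeffFiltration (by simp [trivFiltration])
        refine hA₂.mul_mem (sub_mem ?_ ?_) hz₂
        · simpa using hA₂.mul_mem (hF₂.of_mem hS hS₂ (h0 x)) (hF₂.root_mem hS hS₂)
        · simpa using hA₂.mul_mem (hF₂.of_mem hS hS₂ (h0 y)) (hF₂.of_mem hS hS₂ hT.X_mem))
    (by
      rintro a b z ⟨hz₁, hz₂⟩
      rw [← map_sub] at hz₁ hz₂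
      exact ⟨mem_adjoinFiltration_of_mul hS
          (fun N z hz => mem_coeffFiltration_of_X_sub_C_mul hF hz hreg) hz₁,
        mem_adjoinFiltration_of_mul hS
          (fun N z hz => mem_coeffFiltration_triv_of_X_sub_C_mul hz) hz₂⟩)
    (by
      rintro a b z ⟨hz₁, hz₂⟩
      rw [SetLike.mem_coe, mem_adjoinFiltration] at hz₁ hz₂
      rw [← AdjoinRoot.mk_leftInverse hS z, hθ, diagonalHom_mk, ← AdjoinRoot.aeval_eq,
        aeval_eq_sum_range]
      refine Submodule.sum_mem _ fun i _ => ?_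
      rw [coeff_map, coe_evalRingHom, eval_eq_sum_range, Finset.sum_smul]
      refine Submodule.sum_mem _ fun j _ => ?_
      rcases lt_or_ge (b - (1 : ℕ) * i) (j : ℤ) with h | h
      · rw [coeff_eq_zero_of_mem_triv (hz₂ i) h, zero_mul, zero_smul]
        exact zero_mem _
      · have h1 : ((AdjoinRoot.modByMonicHom hS z).coeff i).coeff j ∈ F a := by
          simpa using hz₁ i j
        have h2 := hF.of_mem hψ hψF' (hF.mul_mem h1 (hF.pow_mem hx j))
        have h3 := hG.mul_mem h2 (hG.pow_mem (hF.root_mem hψ hψF') i)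
        rw [Algebra.smul_def]
        refine hG.mono ?_ h3
        push_cast at h ⊢
        linarith)
    (fun N z hz => mem_adjoinFiltration_of_mul hψ hreg (by simpa [hθof] using hz))
    (fun N => (finiteDimensional_adjoinFiltration hψ hF).1) a b σ
    (fun v => ⟨hσ₁ v, hσ₂ v⟩) n
  refine ⟨W, hW.trans (Nat.add_le_add_left (Finset.sum_le_sum fun j _ =>
    (finiteDimensional_adjoinFiltration hψ hF).2) _), fun v hv => ?_⟩
  obtain ⟨z, hz, -⟩ := hWz v hv n le_rfl
  exact ⟨z, hz⟩

end Polynomial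

section PowerSeriesFacts

variable {k : Type*} [Field k]

lemma PowerSeries.not_X_pow_dvd_aeval {x : PowerSeries k} (hx₀ : PowerSeries.constantCoeff x = 0)
    (hx₁ : PowerSeries.coeff 1 x ≠ 0) {p : Polynomial k} (hp : p ≠ 0) {N : ℕ}
    (hN : p.natDegree < N) : ¬ (PowerSeries.X : PowerSeries k) ^ N ∣ Polynomial.aeval x p := by
  have hx : x.order = 1 := by
    rw [← Nat.cast_one, PowerSeries.order_eq_nat]
    refine ⟨hx₁, fun i hi => ?_⟩
    obtain rfl : i = 0 := by omega
    simpa using hx₀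
  obtain ⟨r, hr, hr0⟩ := Polynomial.exists_eq_pow_rootMultiplicity_mul_and_not_dvd p hp 0
  set e := p.rootMultiplicity 0
  have hr' : (Polynomial.aeval x r).order = 0 := by
    rw [← Nat.cast_zero, PowerSeries.order_eq_nat]
    refine ⟨?_, by simp⟩
    rw [PowerSeries.coeff_zero_eq_constantCoeff, Polynomial.aeval_def, Polynomial.hom_eval₂, hx₀]
    rw [Polynomial.dvd_iff_isRoot, Polynomial.IsRoot.def] at hr0
    have : (PowerSeries.constantCoeff (R := k)).comp (algebraMap k (PowerSeries k)) =
        RingHom.id k := by ext; simp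
    rw [this, Polynomial.eval₂_id]
    exact hr0
  have he : e ≤ p.natDegree := by
    have hr1 : r ≠ 0 := by rintro rfl; simp at hr0
    conv_rhs => rw [hr, (((Polynomial.monic_X_sub_C (0 : k)).pow e)).natDegree_mul' hr1]
    simp
  intro hdvd
  rw [PowerSeries.X_pow_dvd_iff] at hdvd
  have h1 : (Polynomial.aeval x p).order = e := by
    rw [hr, map_mul, map_pow, PowerSeries.order_mul, PowerSeries.order_pow, hr']
    simp [hx]
  rw [PowerSeries.order_eq_nat] at h1
  exact h1.1 (hdvd e (by omega))

/-- A nonzero combination of products `f α * g β ^ q` cannot vanish if no nonzero combination of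
the `f α` vanishes to order `q` and the `g β` are independent. -/
lemma PowerSeries.sum_mul_frobenius_ne_zero [Fintype k] {ι ι' : Type*} [Fintype ι] [Fintype ι']
    (f : ι → PowerSeries k) (g : ι' → PowerSeries k)
    (hf : ∀ c : ι → k, c ≠ 0 → ¬ (PowerSeries.X : PowerSeries k) ^ Fintype.card k ∣ ∑ i, c i • f i)
    (hg : ∀ c : ι' → k, c ≠ 0 → ∑ i, c i • g i ≠ 0) {v : ι → ι' → k} (hv : v ≠ 0) :
    ∑ i, ∑ j, v i j • (f i * g j ^ Fintype.card k) ≠ 0 := by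
  set q := Fintype.card k
  let G : ι → PowerSeries k := fun i => ∑ j, v i j • g j
  have hex : ∃ e, ∃ i, PowerSeries.coeff e (G i) ≠ 0 := by
    obtain ⟨i, hi⟩ := Function.ne_iff.1 hv
    by_contra! h
    exact hg (v i) hi (by ext e; simpa [G] using h e i)
  classical
  set e := Nat.find hex
  obtain ⟨i₀, hi₀⟩ := Nat.find_spec hex
  have hdvd : ∀ i, ∃ K, G i = PowerSeries.X ^ e * K := fun i => by
    refine PowerSeries.X_pow_dvd_iff.2 fun r hr => ?_
    by_contra h
    exact Nat.find_min hex hr ⟨i, h⟩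
  choose K hK using hdvd
  have hL : ∀ i, ∃ L,
      K i = PowerSeries.C (PowerSeries.constantCoeff (K i)) + PowerSeries.X * L := by
    intro i
    have : (PowerSeries.X : PowerSeries k) ∣
        K i - PowerSeries.C (PowerSeries.constantCoeff (K i)) := by
      rw [PowerSeries.X_dvd_iff]
      simp
    obtain ⟨L, hL⟩ := this
    exact ⟨L, by rw [← hL]; ring⟩
  choose L hL using hL
  have hfrob : ∀ a : PowerSeries k, FiniteField.frobeniusAlgHom k (PowerSeries k) a = a ^ q :=
    fun a => rfl
  have hGq : ∀ i, G i ^ q = ∑ j, v i j • g j ^ q := by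
    intro i
    rw [← hfrob, map_sum]
    exact Finset.sum_congr rfl fun j _ => by rw [map_smul, hfrob]
  have hKq : ∀ i, K i ^ q = PowerSeries.C (PowerSeries.constantCoeff (K i)) +
      PowerSeries.X ^ q * L i ^ q := by
    intro i
    conv_lhs => rw [hL i]
    rw [← hfrob, map_add, hfrob, hfrob, mul_pow, ← map_pow, FiniteField.pow_card]
  intro hsum
  have h1 : PowerSeries.X ^ (e * q) * ∑ i, f i * K i ^ q = 0 := by
    rw [← hsum, Finset.mul_sum]
    refine Finset.sum_congr rfl fun i _ => ?_
    calc PowerSeries.X ^ (e * q) * (f i * K i ^ q) = f i * G i ^ q := by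
          rw [hK i, mul_pow, ← pow_mul]; ring
      _ = _ := by
          rw [hGq, Finset.mul_sum]
          exact Finset.sum_congr rfl fun j _ => by rw [mul_smul_comm]
  have h2 : ∑ i, f i * K i ^ q = 0 :=
    (mul_eq_zero.1 h1).resolve_left (pow_ne_zero _ PowerSeries.X_ne_zero)
  refine hf (fun i => PowerSeries.constantCoeff (K i)) ?_ ⟨-∑ i, f i * L i ^ q, ?_⟩
  · intro h
    have h3 := congrFun h i₀
    refine hi₀ ?_
    change PowerSeries.coeff e (G i₀) = 0
    rw [hK i₀, PowerSeries.coeff_X_pow_mul']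
    simpa using h3
  · have h3 : ∀ i, PowerSeries.constantCoeff (K i) • f i =
        f i * K i ^ q - PowerSeries.X ^ q * (f i * L i ^ q) := by
      intro i
      rw [hKq i, PowerSeries.smul_eq_C_mul]
      ring
    rw [Finset.sum_congr rfl fun i _ => h3 i, Finset.sum_sub_distrib, h2, ← Finset.mul_sum]
    ring

end PowerSeriesFacts

namespace Polynomial

variable {k : Type*} [Field k]

lemma dvd_algebraMap_norm {A B : Type*} [CommRing A] [CommRing B] [Algebra A B]
    {ι : Type*} [Fintype ι]
    (b : Module.Basis ι A B) (u : B) : u ∣ algebraMap A B (Algebra.norm A u) := by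
  classical
  set M := Algebra.leftMulMatrix b u
  refine ⟨b.equivFun.symm (M.adjugate.mulVec (b.repr 1)), ?_⟩
  apply b.repr.injective
  apply DFunLike.coe_injective
  rw [← Algebra.leftMulMatrix_mulVec_repr]
  have h1 : (b.repr (b.equivFun.symm (M.adjugate.mulVec (b.repr 1))) : ι → A) =
      M.adjugate.mulVec (b.repr 1) :=
    b.equivFun.apply_symm_apply (M.adjugate.mulVec (b.repr 1))
  rw [h1, Matrix.mulVec_mulVec, Matrix.mul_adjugate, Matrix.smul_mulVec, Matrix.one_mulVec,
    Algebra.norm_eq_matrix_det b, Algebra.algebraMap_eq_smul_one, map_smul]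
  rfl

variable {φ : k[X][X]} (hφ : φ.Monic)

/-- The degree filtration on the coordinate ring of a plane curve. -/
abbrev curveFiltration : ℤ → Submodule k (AdjoinRoot φ) :=
  adjoinFiltration hφ (degreeFiltration k) 1

lemma isMulFiltration_degree : IsMulFiltration (degreeFiltration k) :=
  isMulFiltration_triv.coeffFiltration 1

lemma IsMulFiltration.prod_mem {T ι : Type*} [CommRing T] [Algebra k T] {F : ℤ → Submodule k T}
    (hF : IsMulFiltration F) (s : Finset ι) (a : ι → ℤ) (t : ι → T)
    (h : ∀ i ∈ s, t i ∈ F (a i)) : ∏ i ∈ s, t i ∈ F (∑ i ∈ s, a i) := by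
  classical
  induction s using Finset.induction_on with
  | empty => simpa using hF.one_mem
  | insert i s hi ih =>
    rw [Finset.prod_insert hi, Finset.sum_insert hi]
    exact hF.mul_mem (h i (by simp)) (ih fun j hj => h j (by simp [hj]))

lemma isMulFiltration_curve
    (hφF : φ ∈ coeffFiltration (degreeFiltration k) 1 φ.natDegree) :
    IsMulFiltration (curveFiltration hφ) :=
  isMulFiltration_degree.adjoinFiltration hφ (by simpa using hφF)

lemma norm_mem_degreeFiltration (hφF : φ ∈ coeffFiltration (degreeFiltration k) 1 φ.natDegree)
    {A : ℤ} {u : AdjoinRoot φ} (hu : u ∈ curveFiltration hφ A) :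
    Algebra.norm k[X] u ∈ degreeFiltration k (φ.natDegree * A) := by
  classical
  rw [Algebra.norm_eq_matrix_det (AdjoinRoot.powerBasisAux' hφ), Matrix.det_apply]
  refine Submodule.sum_mem _ fun σ _ => ?_
  have hent : ∀ i j : Fin φ.natDegree, Algebra.leftMulMatrix (AdjoinRoot.powerBasisAux' hφ) u i j ∈
      degreeFiltration k (A + j - i) := by
    intro i j
    rw [Algebra.leftMulMatrix_eq_repr_mul, AdjoinRoot.powerBasisAux'_repr_apply_to_fun]
    have hj : AdjoinRoot.powerBasisAux' hφ j = AdjoinRoot.root φ ^ (j : ℕ) :=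
      (AdjoinRoot.powerBasis' hφ).basis_eq_pow j
    have := (isMulFiltration_curve hφ hφF).mul_mem hu ((isMulFiltration_curve hφ hφF).pow_mem
      (isMulFiltration_degree.root_mem hφ (by simpa using hφF)) j)
    rw [hj]
    simpa using this i
  have h1 := isMulFiltration_degree.prod_mem Finset.univ (fun i : Fin φ.natDegree => A + i - σ i)
    (fun i => Algebra.leftMulMatrix (AdjoinRoot.powerBasisAux' hφ) u (σ i) i)
    (fun i _ => hent (σ i) i)
  have h2 : ∑ i : Fin φ.natDegree, (A + (i : ℕ) - (σ i : ℕ)) = φ.natDegree * A := by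
    rw [Finset.sum_sub_distrib, Finset.sum_add_distrib,
      Equiv.sum_comp σ (fun i : Fin φ.natDegree => ((i : ℕ) : ℤ))]
    simp
  rw [h2] at h1
  rw [Units.smul_def, ← Int.cast_smul_eq_zsmul k]
  exact Submodule.smul_mem _ _ h1

lemma not_X_pow_dvd_of_mem_curveFiltration [IsDomain (AdjoinRoot φ)]
    (ev : AdjoinRoot φ →ₐ[k] PowerSeries k)
    (hx₀ : PowerSeries.constantCoeff (ev (AdjoinRoot.of φ X)) = 0)
    (hx₁ : PowerSeries.coeff 1 (ev (AdjoinRoot.of φ X)) ≠ 0)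
    (hφF : φ ∈ coeffFiltration (degreeFiltration k) 1 φ.natDegree)
    {A q : ℕ} (hq : φ.natDegree * A < q) {u : AdjoinRoot φ} (hu : u ∈ curveFiltration hφ A)
    (hu0 : u ≠ 0) : ¬ (PowerSeries.X : PowerSeries k) ^ q ∣ ev u := by
  have : Module.Free k[X] (AdjoinRoot φ) := hφ.free_adjoinRoot
  have : Module.Finite k[X] (AdjoinRoot φ) := hφ.finite_adjoinRoot
  obtain ⟨w, hw⟩ := dvd_algebraMap_norm (AdjoinRoot.powerBasisAux' hφ) u
  set p := Algebra.norm k[X] u with hp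
  have hp0 : p ≠ 0 := by
    rw [hp, Ne, Algebra.norm_eq_zero_iff_of_basis (AdjoinRoot.powerBasisAux' hφ)]
    exact hu0
  have hpd : p.natDegree ≤ φ.natDegree * A := by
    by_contra! h
    have := norm_mem_degreeFiltration hφ hφF hu
    exact leadingCoeff_ne_zero.2 hp0 (coeff_eq_zero_of_mem_triv this (by exact_mod_cast h))
  have hev : ev (AdjoinRoot.of φ p) = aeval (ev (AdjoinRoot.of φ X)) p := by
    have : (ev.comp (AdjoinRoot.ofAlgHom k φ)) p = aeval (ev (AdjoinRoot.of φ X)) p := by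
      congr 1
      ext
      simp
    simpa using this
  intro hdvd
  refine PowerSeries.not_X_pow_dvd_aeval hx₀ hx₁ hp0 (hpd.trans_lt hq) ?_
  rw [← hev, ← AdjoinRoot.algebraMap_eq, hw, map_mul]
  exact hdvd.mul_right _

end Polynomial

namespace Polynomial

lemma stepanov_dimension_inequality {m n a : ℤ} (hm : 2 ≤ m) (hn : (m + 2) ^ 2 ≤ n)
    (ha : n ^ 2 - m ≤ a) :
    0 < 4 * n * a - 2 * a * (m * (m - 1)) + m ^ 2 * (3 - m) * (2 * n + 1 - m) -
      2 * m * (m - 1) * n * (n + 1) := by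
  obtain ⟨r, rfl⟩ : ∃ r, m = r + 2 := ⟨m - 2, by ring⟩
  obtain ⟨s, rfl⟩ : ∃ s, n = (r + 4) ^ 2 + s := ⟨n - (r + 4) ^ 2, by ring⟩
  have hr : 0 ≤ r := by linarith
  have hs : 0 ≤ s := by nlinarith
  have h1 : 0 ≤ 4 * ((r + 4) ^ 2 + s) - 2 * ((r + 2) * (r + 2 - 1)) := by nlinarith
  have h2 := mul_le_mul_of_nonneg_right ha h1
  refine lt_of_lt_of_le ?_ (show (((r + 4) ^ 2 + s) ^ 2 - (r + 2)) *
    (4 * ((r + 4) ^ 2 + s) - 2 * ((r + 2) * (r + 2 - 1))) +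
      (r + 2) ^ 2 * (3 - (r + 2)) * (2 * ((r + 4) ^ 2 + s) + 1 - (r + 2)) -
      2 * (r + 2) * (r + 2 - 1) * ((r + 4) ^ 2 + s) * ((r + 4) ^ 2 + s + 1) ≤ _ by linarith)
  ring_nf
  positivity

variable {k : Type*} [Field k]

section Monomials

variable {φ : k[X][X]} (hφ : φ.Monic)

/-- Index set of the reduced monomials of degree at most `N`. -/
abbrev MonomialIndex (m N : ℕ) : Type := Σ i : Fin m, Fin (N + 1 - i)

lemma two_mul_card_monomialIndex {m N : ℕ} (h : m ≤ N + 1) :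
    (2 * Fintype.card (MonomialIndex m N) : ℤ) = m * (2 * N + 3 - m) := by
  have h1 : Fintype.card (MonomialIndex m N) = ∑ i ∈ Finset.range m, (N + 1 - i) := by
    rw [Fintype.card_sigma, Finset.sum_range]
    simp
  rw [h1]
  clear h1
  induction m with
  | zero => simp
  | succ m ih =>
    have := ih (by omega)
    rw [Finset.sum_range_succ]
    push_cast at this ⊢
    rw [mul_add, this, Nat.cast_sub (by omega)]
    push_cast
    ring

/-- The monomial `x ^ a * y ^ i` of the coordinate ring. -/
def curveMonomial (φ : k[X][X]) {N : ℕ} (s : MonomialIndex φ.natDegree N) : AdjoinRoot φ :=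
  AdjoinRoot.of φ X ^ (s.2 : ℕ) * AdjoinRoot.root φ ^ (s.1 : ℕ)

lemma linearIndependent_curveMonomial (hφ : φ.Monic) (N : ℕ) :
    LinearIndependent k (curveMonomial φ (N := N)) := by
  let b := (basisMonomials k).smulTower (AdjoinRoot.powerBasisAux' hφ)
  have h1 : curveMonomial φ (N := N) = b ∘ fun s => ((s.2 : ℕ), s.1) := by
    funext s
    have hj : AdjoinRoot.powerBasisAux' hφ s.1 = AdjoinRoot.root φ ^ (s.1 : ℕ) :=
      (AdjoinRoot.powerBasis' hφ).basis_eq_pow s.1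
    rw [Function.comp_apply, Module.Basis.smulTower_apply, coe_basisMonomials, hj]
    beta_reduce
    rw [monomial_one_right_eq_X_pow, Algebra.smul_def, AdjoinRoot.algebraMap_eq, map_pow]
    rfl
  rw [h1]
  refine b.linearIndependent.comp _ ?_
  rintro ⟨i, a⟩ ⟨j, c⟩ h
  simp only [Prod.mk.injEq] at h
  obtain ⟨h2, rfl⟩ := h
  rw [Fin.val_injective h2]

lemma curveMonomial_mem (hφF : φ ∈ coeffFiltration (degreeFiltration k) 1 φ.natDegree) {N : ℕ}
    (s : MonomialIndex φ.natDegree N) : curveMonomial φ s ∈ curveFiltration hφ N := by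
  have hR := isMulFiltration_curve hφ hφF
  have hφF' : φ ∈ coeffFiltration (degreeFiltration k) 1 ((1 : ℕ) * φ.natDegree : ℤ) := by
    simpa using hφF
  have h := hR.mul_mem
    (hR.pow_mem (isMulFiltration_degree.of_mem hφ hφF' isMulFiltration_triv.X_mem) s.2)
    (hR.pow_mem (isMulFiltration_degree.root_mem hφ hφF') s.1)
  refine hR.mono ?_ h
  have := s.2.2
  push_cast
  omega

end Monomials

section Finite

variable [Fintype k] {φ : k[X][X]} (hφ : φ.Monic)

lemma prod_X_sub_C_univ : ∏ c : k, (X - C c) = X ^ Fintype.card k - X := by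
  have hq : 1 < Fintype.card k := Fintype.one_lt_card
  have h := prod_multiset_X_sub_C_of_monic_of_roots_card_eq (p := (X ^ Fintype.card k - X : k[X]))
    (monic_X_pow_sub (by rw [degree_X]; exact_mod_cast hq))
    (by rw [FiniteField.roots_X_pow_card_sub_X, FiniteField.X_pow_card_sub_X_natDegree_eq k hq]
        rfl)
  rw [FiniteField.roots_X_pow_card_sub_X] at h
  exact h

/-- The product of the values of `φ` on all horizontal lines. -/
def fiberProduct (φ : k[X][X]) : k[X] := ∏ c : k, φ.eval (C c)

lemma of_fiberProduct (φ : k[X][X]) : ∃ s, AdjoinRoot.of φ (fiberProduct φ) =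
    (AdjoinRoot.root φ ^ Fintype.card k - AdjoinRoot.root φ) * s := by
  have h1 : ∀ c : k, ∃ s, AdjoinRoot.of φ (φ.eval (C c)) =
      (AdjoinRoot.root φ - algebraMap k _ c) * s := by
    intro c
    obtain ⟨s, hs⟩ := X_sub_C_dvd_sub_C_eval (p := φ) (a := C c)
    refine ⟨-AdjoinRoot.mk φ s, ?_⟩
    have := congrArg (AdjoinRoot.mk φ) hs
    rw [map_sub, AdjoinRoot.mk_self, AdjoinRoot.mk_C, map_mul, map_sub, AdjoinRoot.mk_X,
      AdjoinRoot.mk_C] at this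
    rw [show algebraMap k (AdjoinRoot φ) c = AdjoinRoot.of φ (C c) from rfl]
    linear_combination -this
  choose s hs using h1
  refine ⟨∏ c, s c, ?_⟩
  rw [fiberProduct, map_prod, Finset.prod_congr rfl fun c _ => hs c, Finset.prod_mul_distrib]
  congr 1
  have := congrArg (aeval (AdjoinRoot.root φ)) (prod_X_sub_C_univ (k := k))
  simpa using this

/-- A function vanishing to order `n` at all points over many `x`-coordinates, of small degree,
is zero. -/
lemma eq_zero_of_frobenius_pow_mul_eq {D n : ℕ} {h g : AdjoinRoot φ}
    (hh : h ∈ curveFiltration hφ D)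
    (heq : (AdjoinRoot.root φ ^ Fintype.card k - AdjoinRoot.root φ) ^ n * h =
      (AdjoinRoot.of φ X ^ Fintype.card k - AdjoinRoot.of φ X) ^ n * g)
    (good : Finset k) (hgood : ∀ x₁ ∈ good, (fiberProduct φ).eval x₁ ≠ 0)
    (hD : D < n * good.card) : h = 0 := by
  obtain ⟨s, hs⟩ := of_fiberProduct φ
  have h1 : AdjoinRoot.of φ (fiberProduct φ ^ n) * h =
      AdjoinRoot.of φ ((X ^ Fintype.card k - X) ^ n) * (s ^ n * g) := by
    rw [map_pow, hs, map_pow, map_sub, map_pow, mul_pow]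
    linear_combination s ^ n * heq
  have h2 : AdjoinRoot.modByMonicHom hφ h = 0 := by
    refine Polynomial.ext fun i => ?_
    have h3 : fiberProduct φ ^ n * (AdjoinRoot.modByMonicHom hφ h).coeff i =
        (X ^ Fintype.card k - X) ^ n * (AdjoinRoot.modByMonicHom hφ (s ^ n * g)).coeff i := by
      have := congrArg (fun z => (AdjoinRoot.modByMonicHom hφ z).coeff i) h1
      simpa only [modByMonicHom_of_mul, coeff_smul, smul_eq_mul] using this
    set p := (AdjoinRoot.modByMonicHom hφ h).coeff i
    have hdvd : ∏ x₁ ∈ good, (X - C x₁) ^ n ∣ p := by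
      refine Finset.prod_dvd_of_coprime (fun a _ b _ hab => ?_) fun a ha => ?_
      · exact (pairwise_coprime_X_sub_C Function.injective_id hab).pow
      · have hcop : IsCoprime ((X - C a) ^ n) (fiberProduct φ ^ n) := by
          refine IsCoprime.pow ((irreducible_X_sub_C a).coprime_iff_not_dvd.2 ?_)
          rw [dvd_iff_isRoot]
          exact hgood a ha
        refine hcop.dvd_of_dvd_mul_left (h3 ▸ (pow_dvd_pow_of_dvd ?_ n).mul_right _)
        rw [← prod_X_sub_C_univ]
        exact Finset.dvd_prod_of_mem _ (Finset.mem_univ a)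
    rw [coeff_zero]
    by_contra hp
    have hdeg := natDegree_le_of_dvd hdvd hp
    rw [natDegree_prod_of_monic _ _ fun a _ => (monic_X_sub_C a).pow n] at hdeg
    simp only [natDegree_pow, natDegree_X_sub_C, mul_one, Finset.sum_const, smul_eq_mul] at hdeg
    refine leadingCoeff_ne_zero.2 hp (coeff_eq_zero_of_mem_triv (hh i) ?_)
    have : (D : ℤ) < good.card * n := by rw [mul_comm]; exact_mod_cast hD
    have : (good.card * n : ℤ) ≤ p.natDegree := by exact_mod_cast hdeg
    have : (0 : ℤ) ≤ i := by positivity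
    push_cast
    linarith
  rw [← AdjoinRoot.mk_leftInverse hφ h, h2, map_zero]

/-- Restriction of functions on the product of a curve with itself to the graph of Frobenius. -/
def frobeniusGraphHom (φ : k[X][X]) :
    AdjoinRoot (mapBase (AdjoinRoot φ) φ) →ₐ[k] AdjoinRoot φ :=
  AdjoinRoot.liftAlgHom _ ((aeval (AdjoinRoot.of φ X ^ Fintype.card k)).restrictScalars k)
    (AdjoinRoot.root φ ^ Fintype.card k) (by
      rw [mapBase, eval₂_map]
      have h1 : (((aeval (AdjoinRoot.of φ X ^ Fintype.card k) :
          (AdjoinRoot φ)[X] →ₐ[AdjoinRoot φ] AdjoinRoot φ).restrictScalars k :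
          (AdjoinRoot φ)[X] →ₐ[k] AdjoinRoot φ) : (AdjoinRoot φ)[X] →+* AdjoinRoot φ).comp
          (mapRingHom (algebraMap k (AdjoinRoot φ))) =
          ((FiniteField.frobeniusAlgHom k (AdjoinRoot φ) : AdjoinRoot φ →ₐ[k] AdjoinRoot φ) :
            AdjoinRoot φ →+* AdjoinRoot φ).comp (AdjoinRoot.of φ) := by
        ext c
        · have : AdjoinRoot.of φ (C c) = algebraMap k (AdjoinRoot φ) c := rfl
          simp only [RingHom.coe_comp, Function.comp_apply, coe_mapRingHom, map_C, this,
            RingHom.coe_coe, AlgHom.commutes]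
          simp
        · simp
      rw [h1]
      have h2 := hom_eval₂ φ (AdjoinRoot.of φ)
        ((FiniteField.frobeniusAlgHom k (AdjoinRoot φ) : AdjoinRoot φ →ₐ[k] AdjoinRoot φ) :
            AdjoinRoot φ →+* AdjoinRoot φ) (AdjoinRoot.root φ)
      rw [AdjoinRoot.eval₂_root, map_zero] at h2
      exact h2.symm)

lemma frobeniusGraphHom_of (φ : k[X][X]) (p : (AdjoinRoot φ)[X]) :
    frobeniusGraphHom φ (AdjoinRoot.of _ p) = p.eval (AdjoinRoot.of φ X ^ Fintype.card k) := by
  rw [frobeniusGraphHom, AdjoinRoot.liftAlgHom_of]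
  simp [aeval_def, eval₂_eq_eval_map]

lemma frobeniusGraphHom_root (φ : k[X][X]) :
    frobeniusGraphHom φ (AdjoinRoot.root _) = AdjoinRoot.root φ ^ Fintype.card k := by
  rw [frobeniusGraphHom, AdjoinRoot.liftAlgHom_root]

end Finite

end Polynomial

namespace Polynomial

variable {k : Type*} [Field k]

section Auxiliary

variable {φ : k[X][X]} (hφ : φ.Monic)

lemma finiteDimensional_curveFiltration (N : ℤ) :
    FiniteDimensional k (curveFiltration hφ N) ∧
      Module.finrank k (curveFiltration hφ N) ≤ φ.natDegree * (N + 1).toNat := by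
  have h := finiteDimensional_coeffFiltration_triv (k := k) N
  have := h.1
  have h1 := finiteDimensional_adjoinFiltration hφ (isMulFiltration_degree (k := k)) (w := 1)
    (N := N)
  exact ⟨h1.1, h1.2.trans (Nat.mul_le_mul_left _ h.2)⟩

lemma mem_curveFiltration_of_X_mul {N : ℤ} {z : AdjoinRoot φ}
    (hz : AdjoinRoot.of φ X * z ∈ curveFiltration hφ (N + 1)) : z ∈ curveFiltration hφ N :=
  mem_adjoinFiltration_of_mul hφ (fun N z hz => mem_coeffFiltration_triv_of_X_sub_C_mul (a := 0)
    (by simpa using hz)) hz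

lemma specFst_of_X (φ : k[X][X]) : specFst (AdjoinRoot.of φ X) φ = φ.map (AdjoinRoot.of φ) := by
  rw [specFst]
  congr 1
  ext c
  · simp
    rfl
  · simp

lemma exists_specFst_eq_mul
    (hφF : φ ∈ coeffFiltration (degreeFiltration k) 1 φ.natDegree)
    [Nontrivial (AdjoinRoot φ)] :
    ∃ ψ : (AdjoinRoot φ)[X], ψ.Monic ∧ ψ.natDegree = φ.natDegree - 1 ∧
      specFst (AdjoinRoot.of φ X) φ = (X - C (AdjoinRoot.root φ)) * ψ ∧
      ψ ∈ coeffFiltration (curveFiltration hφ) 1 ψ.natDegree := by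
  have hR := isMulFiltration_curve hφ hφF
  have hφF' : φ ∈ coeffFiltration (degreeFiltration k) 1 ((1 : ℕ) * φ.natDegree : ℤ) := by
    simpa using hφF
  have hx : AdjoinRoot.of φ X ∈ curveFiltration hφ 1 :=
    isMulFiltration_degree.of_mem hφ hφF' isMulFiltration_triv.X_mem
  have hy : AdjoinRoot.root φ ∈ curveFiltration hφ 1 :=
    isMulFiltration_degree.root_mem hφ hφF'
  have hroot : (specFst (AdjoinRoot.of φ X) φ).IsRoot (AdjoinRoot.root φ) := by
    rw [specFst_of_X, IsRoot.def, eval_map, AdjoinRoot.eval₂_root]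
  have hmul := mul_divByMonic_eq_iff_isRoot.2 hroot
  set ψ := specFst (AdjoinRoot.of φ X) φ /ₘ (X - C (AdjoinRoot.root φ)) with hψ
  have hmon : (specFst (AdjoinRoot.of φ X) φ).Monic := hφ.map _
  have hdeg : ψ.natDegree = φ.natDegree - 1 := by
    rw [hψ, natDegree_divByMonic _ (monic_X_sub_C _), natDegree_X_sub_C, specFst,
      hφ.natDegree_map]
  refine ⟨ψ, (monic_X_sub_C _).of_mul_monic_left (hmul ▸ hmon), hdeg, hmul.symm, ?_⟩
  have hm : 1 ≤ φ.natDegree := by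
    rw [Nat.one_le_iff_ne_zero]
    intro h0
    obtain rfl := eq_one_of_monic_natDegree_zero hφ h0
    simp [specFst] at hroot
  refine mem_coeffFiltration_of_X_sub_C_mul_eq hR hy (p := specFst (AdjoinRoot.of φ X) φ) ?_
    hmul.symm
  intro i
  rw [specFst, coeff_map]
  have := hR.aeval_mem hx (hφF i)
  rw [hdeg]
  refine hR.mono (le_of_eq ?_) this
  push_cast [Nat.cast_sub hm]
  ring

lemma exists_product_taylor_vanishing (hφ : φ.Monic)
    (hφF : φ ∈ coeffFiltration (degreeFiltration k) 1 φ.natDegree)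
    [Nontrivial (AdjoinRoot φ)] (A B : ℕ)
    (hdim : (φ.natDegree - 1) * φ.natDegree * ∑ j ∈ Finset.range (B + 1), (A + B + 1 - j) <
      Fintype.card (MonomialIndex φ.natDegree A) * Fintype.card (MonomialIndex φ.natDegree B)) :
    ∃ v : MonomialIndex φ.natDegree A → MonomialIndex φ.natDegree B → k, v ≠ 0 ∧ ∃ z,
      (AdjoinRoot.root (mapBase (AdjoinRoot φ) φ) -
        AdjoinRoot.of (mapBase (AdjoinRoot φ) φ) (C (AdjoinRoot.root φ))) ^ (B + 1) *
        ∑ α, ∑ β, v α β • (AdjoinRoot.of (mapBase (AdjoinRoot φ) φ) (C (curveMonomial φ α)) *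
          (AdjoinRoot.of (mapBase (AdjoinRoot φ) φ) X ^ (β.2 : ℕ) *
            AdjoinRoot.root (mapBase (AdjoinRoot φ) φ) ^ (β.1 : ℕ))) =
      (AdjoinRoot.of (mapBase (AdjoinRoot φ) φ) X -
        AdjoinRoot.of (mapBase (AdjoinRoot φ) φ) (C (AdjoinRoot.of φ X))) ^ (B + 1) * z := by
  have hR := isMulFiltration_curve hφ hφF
  have hφF' : φ ∈ coeffFiltration (degreeFiltration k) 1 ((1 : ℕ) * φ.natDegree : ℤ) := by
    simpa using hφF
  have hx : AdjoinRoot.of φ X ∈ curveFiltration hφ 1 :=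
    isMulFiltration_degree.of_mem hφ hφF' isMulFiltration_triv.X_mem
  have hy : AdjoinRoot.root φ ∈ curveFiltration hφ 1 :=
    isMulFiltration_degree.root_mem hφ hφF'
  obtain ⟨ψ, hψ, hψdeg, hφψ, hψF⟩ := exists_specFst_eq_mul hφ hφF
  have hS := hφ.map (mapRingHom (algebraMap k (AdjoinRoot φ)))
  have hT : IsMulFiltration (trivFiltration k (AdjoinRoot φ)) := isMulFiltration_triv
  have hF₁ : IsMulFiltration (coeffFiltration (curveFiltration hφ) 0) := hR.coeffFiltration 0
  have hF₂ : IsMulFiltration (coeffFiltration (trivFiltration k (AdjoinRoot φ)) 1) :=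
    hT.coeffFiltration 1
  have hS₁ := mapBase_mem_coeffFiltration_left hR φ
  have hS₂ := mapBase_mem_coeffFiltration_right (R := AdjoinRoot φ) hφ hφF
  have hA₁ := hF₁.adjoinFiltration hS hS₁
  have hA₂ := hF₂.adjoinFiltration hS hS₂
  let S : MonomialIndex φ.natDegree A × MonomialIndex φ.natDegree B →
      AdjoinRoot (mapBase (AdjoinRoot φ) φ) := fun p =>
    AdjoinRoot.of (mapBase (AdjoinRoot φ) φ) (C (curveMonomial φ p.1)) *
          (AdjoinRoot.of (mapBase (AdjoinRoot φ) φ) X ^ (p.2.2 : ℕ) *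
            AdjoinRoot.root (mapBase (AdjoinRoot φ) φ) ^ (p.2.1 : ℕ))
  have hS1 : ∀ p, S p ∈ adjoinFiltration hS (coeffFiltration (curveFiltration hφ) 0) 0 A := by
    intro p
    have := hA₁.mul_mem (hF₁.of_mem hS hS₁ (C_mem_coeffFiltration (curveMonomial_mem hφ hφF p.1)))
      (hA₁.mul_mem (hA₁.pow_mem (hF₁.of_mem hS hS₁ hR.X_mem) p.2.2)
        (hA₁.pow_mem (hF₁.root_mem hS hS₁) p.2.1))
    simpa using this
  have hS2 : ∀ p, S p ∈ adjoinFiltration hS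
      (coeffFiltration (trivFiltration k (AdjoinRoot φ)) 1) 1 B := by
    intro p
    have h0 : ∀ r : AdjoinRoot φ, C r ∈ coeffFiltration (trivFiltration k (AdjoinRoot φ)) 1 0 :=
      fun r => C_mem_coeffFiltration (by simp [trivFiltration])
    have := hA₂.mul_mem (hF₂.of_mem hS hS₂ (h0 (curveMonomial φ p.1)))
      (hA₂.mul_mem (hA₂.pow_mem (hF₂.of_mem hS hS₂ hT.X_mem) p.2.2)
        (hA₂.pow_mem (hF₂.root_mem hS hS₂) p.2.1))
    refine hA₂.mono ?_ this
    have := p.2.2.2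
    push_cast
    omega
  obtain ⟨W, hW, hWz⟩ := exists_submodule_taylor_vanishing_curve hR hx hy
    (fun N z hz => mem_curveFiltration_of_X_mul hφ hz) hφ hφF hψ hφψ hψF
    (fun N => (finiteDimensional_curveFiltration hφ N).1) A B (Fintype.linearCombination k S)
    (fun v => by
      rw [Fintype.linearCombination_apply]
      exact Submodule.sum_mem _ fun p _ => Submodule.smul_mem _ _ (hS1 p))
    (fun v => by
      rw [Fintype.linearCombination_apply]
      exact Submodule.sum_mem _ fun p _ => Submodule.smul_mem _ _ (hS2 p)) (B + 1)
  have hlt : ∑ j ∈ Finset.range (B + 1),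
      ψ.natDegree * Module.finrank k (curveFiltration hφ ((A : ℤ) + B - j)) <
      Module.finrank k (MonomialIndex φ.natDegree A × MonomialIndex φ.natDegree B → k) := by
    rw [Module.finrank_fintype_fun_eq_card, Fintype.card_prod]
    refine lt_of_le_of_lt ?_ hdim
    rw [Finset.mul_sum]
    refine Finset.sum_le_sum fun j hj => ?_
    rw [hψdeg, mul_assoc]
    refine Nat.mul_le_mul_left _ ((finiteDimensional_curveFiltration hφ _).2.trans ?_)
    refine Nat.mul_le_mul_left _ ?_
    omega
  have hWb : W ≠ ⊥ := by
    rintro rfl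
    rw [finrank_bot] at hW
    omega
  obtain ⟨v, hv, hv0⟩ := Submodule.exists_mem_ne_zero_of_ne_bot hWb
  obtain ⟨z, hz⟩ := hWz v hv
  refine ⟨fun α β => v (α, β), fun h => hv0 ?_, z, ?_⟩
  · funext p
    exact congrFun (congrFun h p.1) p.2
  · rw [← hz, Fintype.linearCombination_apply, Fintype.sum_prod_type]

end Auxiliary

end Polynomial

namespace Polynomial

variable {k : Type*} [Field k] [Fintype k]

lemma stepanov_dimension_lt {m n q A : ℕ} (hm : 2 ≤ m) (hmn : (m + 2) ^ 2 ≤ n + 1)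
    (hn : (n + 1) ^ 2 ≤ q) (hA : q ≤ m * A + m) :
    (m - 1) * m * ∑ j ∈ Finset.range (n + 1), (A + n + 1 - j) <
      Fintype.card (MonomialIndex m A) * Fintype.card (MonomialIndex m n) := by
  have hmA : m ≤ A + 1 := by nlinarith
  have hmB : m ≤ n + 1 := by nlinarith
  have h1 := two_mul_card_monomialIndex hmA
  have h2 := two_mul_card_monomialIndex hmB
  have h3 : ∀ N ≤ n + 1, (2 * (∑ j ∈ Finset.range N, (A + n + 1 - j) : ℕ) : ℤ) =
      N * (2 * A + 2 * n + 3 - N) := by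
    intro N hN
    induction N with
    | zero => simp
    | succ N ih =>
      rw [Finset.sum_range_succ, Nat.cast_add, mul_add, ih (by omega), Nat.cast_sub (by omega)]
      push_cast
      ring
  have h3 := h3 _ le_rfl
  have h4 := stepanov_dimension_inequality (m := m) (n := n + 1) (a := m * A)
    (by exact_mod_cast hm) (by exact_mod_cast hmn) (by
      have : ((n + 1) ^ 2 : ℤ) ≤ m * A + m := by exact_mod_cast hn.trans hA
      linarith)
  set a := Fintype.card (MonomialIndex m A)
  set b := Fintype.card (MonomialIndex m n)
  set s := ∑ j ∈ Finset.range (n + 1), (A + n + 1 - j)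
  zify [show 1 ≤ m by omega]
  have h6 : (4 * (a * b) : ℤ) = (m * (2 * A + 3 - m)) * (m * (2 * n + 3 - m)) := by
    rw [← h1, ← h2]; ring
  have h7 : (4 * ((m - 1) * m * s) : ℤ) =
      2 * (m - 1) * m * ((n + 1) * (2 * A + 2 * n + 3 - (n + 1))) := by
    push_cast at h3
    rw [← h3]
    ring
  linarith

lemma stepanov_degree_lt {q n A c : ℕ} (hq : 1 ≤ q) (hc : c ≤ q) (hA : 2 * A ≤ q - 1)
    (hbad : 2 * (q - c) * (n + 1) ≤ q) : A + q * n < (n + 1) * c := by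
  obtain ⟨b, rfl⟩ := Nat.exists_eq_add_of_le hc
  rw [Nat.add_sub_cancel_left] at hbad
  have h1 : 2 * (b * n) + 2 * b ≤ c + b := by linarith
  have h2 : A + b * n < c := by omega
  linarith

/-- A plane curve over a finite field cannot have few rational points on almost all vertical lines
and at the same time a rational branch at infinity. -/
theorem false_of_branch_of_irreducible {φ : k[X][X]} (hφ : φ.Monic) (hirr : Irreducible φ)
    (hφF : φ ∈ coeffFiltration (degreeFiltration k) 1 φ.natDegree)
    (ev : AdjoinRoot φ →ₐ[k] PowerSeries k)
    (hx₀ : PowerSeries.constantCoeff (ev (AdjoinRoot.of φ X)) = 0)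
    (hx₁ : PowerSeries.coeff 1 (ev (AdjoinRoot.of φ X)) ≠ 0)
    {n : ℕ} (hn : n ^ 2 ≤ Fintype.card k) (hmn : (φ.natDegree + 2) ^ 2 ≤ n)
    (good : Finset k) (hgood : ∀ x₁ ∈ good, (fiberProduct φ).eval x₁ ≠ 0)
    (hbad : 2 * (Fintype.card k - good.card) * n ≤ Fintype.card k) : False := by
  have : IsDomain (AdjoinRoot φ) := AdjoinRoot.isDomain_of_prime hirr.prime
  have hq : 1 < Fintype.card k := Fintype.one_lt_card
  have hgc : good.card ≤ Fintype.card k := Finset.card_le_univ good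
  have hm0 : φ.natDegree ≠ 0 := fun h0 =>
    hirr.not_isUnit (eq_one_of_monic_natDegree_zero hφ h0 ▸ isUnit_one)
  have hm : 2 ≤ φ.natDegree := by
    by_contra hlt
    have hm1 : φ.natDegree = 1 := by omega
    have hne : good.Nonempty := by
      rw [← Finset.card_pos, Nat.pos_iff_ne_zero]
      intro h0
      rw [h0, Nat.sub_zero] at hbad
      have : 9 ≤ n := by rw [hm1] at hmn; omega
      nlinarith
    obtain ⟨x₁, hx⟩ := hne
    refine hgood x₁ hx ?_
    rw [fiberProduct, eval_prod]
    refine Finset.prod_eq_zero (Finset.mem_univ (-(φ.coeff 0).eval x₁)) ?_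
    rw [hφ.as_sum, hm1]
    simp
  obtain ⟨n, rfl⟩ : ∃ n', n = n' + 1 := ⟨n - 1, by
    have : 0 < (φ.natDegree + 2) ^ 2 := by positivity
    omega⟩
  set q := Fintype.card k with hqdef
  set m := φ.natDegree with hmdef
  set A := (q - 1) / m with hAdef
  have hA1 : m * A ≤ q - 1 := Nat.mul_div_le _ _
  have hA2 : q ≤ m * A + m := by
    have := Nat.lt_mul_div_succ (q - 1) (show 0 < m by omega)
    rw [← hAdef, mul_add, mul_one] at this
    omega
  obtain ⟨v, hv, z, hz⟩ := exists_product_taylor_vanishing hφ hφF A n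
    (stepanov_dimension_lt hm hmn hn hA2)
  have hR := isMulFiltration_curve hφ hφF
  have h1 := congrArg (frobeniusGraphHom φ) hz
  simp only [map_mul, map_pow, map_sub, map_sum, map_smul, frobeniusGraphHom_of,
    frobeniusGraphHom_root, eval_C, eval_X] at h1
  have hh : ∑ α, ∑ β, v α β • (curveMonomial φ α * curveMonomial φ β ^ q) = 0 := by
    refine eq_zero_of_frobenius_pow_mul_eq hφ (D := A + q * n) (n := n + 1)
      (Submodule.sum_mem _ fun α _ => Submodule.sum_mem _ fun β _ => Submodule.smul_mem _ _ ?_)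
      (g := frobeniusGraphHom φ z) ?_ good hgood ?_
    · have := hR.mul_mem (curveMonomial_mem hφ hφF α)
        (hR.pow_mem (curveMonomial_mem hφ hφF β) q)
      exact_mod_cast this
    · have hpow : ∀ β : MonomialIndex m n, curveMonomial φ β ^ q =
          (AdjoinRoot.of φ X ^ q) ^ (β.2 : ℕ) * (AdjoinRoot.root φ ^ q) ^ (β.1 : ℕ) := by
        intro β
        rw [curveMonomial, mul_pow, pow_right_comm, pow_right_comm (AdjoinRoot.root φ)]
      rw [← h1, Finset.sum_congr rfl fun α _ => Finset.sum_congr rfl fun β _ => by rw [hpow β]]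
    · have h2 : 2 * A ≤ q - 1 := le_trans (Nat.mul_le_mul_right _ hm) hA1
      exact stepanov_degree_lt hq.le hgc h2 hbad
  have hev := congrArg ev hh
  simp only [map_sum, map_smul, map_mul, map_pow, map_zero] at hev
  have hnd : ∀ N : ℕ, ∀ Q : ℕ, m * N < Q → ∀ c : MonomialIndex m N → k, c ≠ 0 →
      ¬ (PowerSeries.X : PowerSeries k) ^ Q ∣ ∑ i, c i • ev (curveMonomial φ i) := by
    intro N Q hQ c hc
    have := not_X_pow_dvd_of_mem_curveFiltration hφ ev hx₀ hx₁ hφF hQ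
      (u := ∑ i, c i • curveMonomial φ i)
      (Submodule.sum_mem _ fun i _ => Submodule.smul_mem _ _ (curveMonomial_mem hφ hφF i))
      (fun h0 => hc (by
        funext i
        exact Fintype.linearIndependent_iff.1 (linearIndependent_curveMonomial hφ N) c h0 i))
    simpa only [map_sum, map_smul] using this
  refine PowerSeries.sum_mul_frobenius_ne_zero (fun α => ev (curveMonomial φ α))
    (fun β => ev (curveMonomial φ β)) (hnd A q (by omega)) (fun c hc h0 => ?_) hv hev
  exact hnd n (m * n + 1) (by omega) c hc (h0 ▸ dvd_zero _)

end Polynomial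

namespace Polynomial

variable {k : Type*} [Field k]

/-- The dehomogenised grading map, sending `a X ^ j Y ^ i` to `a X ^ j Z ^ (i + j)`. -/
def gradingHom (k : Type*) [Field k] : k[X][X] →+* k[X][X] :=
  eval₂RingHom (eval₂RingHom (C.comp C) (C X * X)) X

lemma coeff_coeff_gradingHom (f : k[X][X]) (w j : ℕ) :
    ((gradingHom k f).coeff w).coeff j = if j ≤ w then (f.coeff (w - j)).coeff j else 0 := by
  induction f using Polynomial.induction_on' with
  | add p r hp hr =>
    rw [map_add, coeff_add, coeff_add, hp, hr]
    split_ifs <;> simp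
  | monomial i p =>
    induction p using Polynomial.induction_on' with
    | add p r hp hr =>
      rw [map_add, map_add, coeff_add, coeff_add, hp, hr]
      split_ifs <;> simp
    | monomial l a =>
      have : gradingHom k (monomial i (monomial l a)) = monomial (l + i) (monomial l a) := by
        simp only [gradingHom, coe_eval₂RingHom, eval₂_monomial, RingHom.comp_apply]
        rw [mul_pow, ← C_pow, ← mul_assoc, ← C_mul, mul_assoc, ← pow_add,
          C_mul_X_pow_eq_monomial, C_mul_X_pow_eq_monomial]
      rw [this]
      simp only [coeff_monomial]
      split_ifs <;> first | rfl | simp_all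
      all_goals simp only [coeff_monomial]
      all_goals split_ifs <;> first | rfl | omega

lemma mem_degree_coeffFiltration_iff {f : k[X][X]} {N : ℕ} :
    f ∈ coeffFiltration (degreeFiltration k) 1 N ↔ (gradingHom k f).natDegree ≤ N := by
  rw [natDegree_le_iff_coeff_eq_zero]
  constructor
  · intro h w hw
    ext j
    rw [coeff_coeff_gradingHom, coeff_zero]
    split_ifs with hj
    · exact coeff_eq_zero_of_mem_triv (h _) (by push_cast [Nat.cast_sub hj]; omega)
    · rfl
  · intro h i
    refine mem_coeffFiltration_triv fun j hj => ?_
    have := congrArg (coeff · j) (h (i + j) (by push_cast at hj; omega))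
    simpa [coeff_coeff_gradingHom] using this

lemma Monic.natDegree_le_gradingHom {f : k[X][X]} (hf : f.Monic) :
    f.natDegree ≤ (gradingHom k f).natDegree := by
  refine le_natDegree_of_ne_zero fun h => ?_
  have := congrArg (coeff · 0) h
  simp [coeff_coeff_gradingHom, hf.coeff_natDegree] at this

lemma Monic.mem_coeffFiltration_of_mul {f g : k[X][X]} (hf : f.Monic) (hg : g.Monic)
    (h : f * g ∈ coeffFiltration (degreeFiltration k) 1 ((f * g).natDegree : ℕ)) :
    f ∈ coeffFiltration (degreeFiltration k) 1 f.natDegree := by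
  have h0 : ∀ p : k[X][X], p.Monic → gradingHom k p ≠ 0 := by
    intro p hp h
    have := congrArg (fun r => (r.coeff p.natDegree).coeff 0) h
    simp [coeff_coeff_gradingHom, hp.coeff_natDegree] at this
  rw [mem_degree_coeffFiltration_iff, map_mul, Polynomial.natDegree_mul (h0 f hf) (h0 g hg),
    hf.natDegree_mul hg] at h
  have := hg.natDegree_le_gradingHom
  exact mem_degree_coeffFiltration_iff.2 (by omega)

theorem false_of_branch [Fintype k] {n : ℕ} (hn : n ^ 2 ≤ Fintype.card k) (good : Finset k)
    (hbad : 2 * (Fintype.card k - good.card) * n ≤ Fintype.card k)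
    {x y : PowerSeries k} (hx₀ : PowerSeries.constantCoeff x = 0)
    (hx₁ : PowerSeries.coeff 1 x ≠ 0) {G : k[X][X]} (hG : G.Monic)
    (hGF : G ∈ coeffFiltration (degreeFiltration k) 1 G.natDegree)
    (hxy : G.eval₂ ((aeval x : k[X] →ₐ[k] PowerSeries k) : k[X] →+* PowerSeries k) y = 0)
    (hGn : (G.natDegree + 2) ^ 2 ≤ n)
    (hgood : ∀ s ∈ good, ∀ c, (G.eval (C c)).eval s ≠ 0) : False := by
  induction hm : G.natDegree using Nat.strong_induction_on generalizing G with
  | _ m ih =>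
  have hG1 : G ≠ 1 := by
    rintro rfl
    simp at hxy
  by_cases hirr : Irreducible G
  · refine false_of_branch_of_irreducible hG hirr hGF (AdjoinRoot.liftAlgHom G (aeval x) y hxy)
      ?_ ?_ hn hGn good (fun s hs => ?_) hbad
    · simpa using hx₀
    · simpa using hx₁
    · rw [fiberProduct, eval_prod]
      exact Finset.prod_ne_zero_iff.2 fun c _ => hgood s hs c
  · rw [hG.irreducible_iff_natDegree'] at hirr
    push Not at hirr
    obtain ⟨f, g, hf, hg, rfl, hfg⟩ := hirr hG1
    rw [Finset.mem_Ioc] at hfg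
    have hdeg := hf.natDegree_mul hg
    rw [eval₂_mul, mul_eq_zero] at hxy
    rcases hxy with h | h
    · refine ih f.natDegree (by omega) hf (hf.mem_coeffFiltration_of_mul hg hGF) h ?_
        (fun s hs c h0 => hgood s hs c (by rw [eval_mul, eval_mul, h0, zero_mul])) rfl
      exact le_trans (Nat.pow_le_pow_left (by omega) 2) hGn
    · refine ih g.natDegree (by omega) hg (hg.mem_coeffFiltration_of_mul hf (mul_comm f g ▸ hGF)) h
        ?_ (fun s hs c h0 => hgood s hs c (by rw [eval_mul, eval_mul, h0, mul_zero])) rfl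
      exact le_trans (Nat.pow_le_pow_left (by omega) 2) hGn

end Polynomial

namespace Polynomial

variable {k : Type*} [Field k]

lemma aeval_eq_sum_support_fin_two {T : Type*} [CommRing T] [Algebra k T]
    (P : MvPolynomial (Fin 2) k) (x y : T) :
    MvPolynomial.aeval ![x, y] P =
      ∑ m ∈ P.support, P.coeff m • (x ^ m 0 * y ^ m 1) := by
  rw [MvPolynomial.aeval_def, MvPolynomial.eval₂_eq']
  simp [Fin.prod_univ_two, Algebra.smul_def]

lemma IsMulFiltration.aeval_fin_two_mem {T : Type*} [CommRing T] [Algebra k T]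
    {F : ℤ → Submodule k T} (hF : IsMulFiltration F) {P : MvPolynomial (Fin 2) k} {D : ℕ}
    (hP : ∀ m ∈ P.support, m 0 + m 1 ≤ D) {x y : T} (hx : x ∈ F 1) (hy : y ∈ F 1) :
    MvPolynomial.aeval ![x, y] P ∈ F D := by
  rw [aeval_eq_sum_support_fin_two]
  refine Submodule.sum_mem _ fun m hm => Submodule.smul_mem _ _ ?_
  refine hF.mono ?_ (hF.mul_mem (hF.pow_mem hx (m 0)) (hF.pow_mem hy (m 1)))
  have := hP m hm
  omega

section Shear

variable {P : MvPolynomial (Fin 2) k} {D : ℕ}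

/-- The polynomial `P(X, s + c X)`, as a polynomial in `X` over `k[s]`. -/
def shear (c : k) (P : MvPolynomial (Fin 2) k) : k[X][X] :=
  MvPolynomial.aeval ![X, C X + C (C c) * X] P

lemma shear_mem (hP : ∀ m ∈ P.support, m 0 + m 1 ≤ D) (c : k) :
    shear c P ∈ coeffFiltration (degreeFiltration k) 1 D := by
  have hF := (isMulFiltration_degree (k := k)).coeffFiltration 1
  refine hF.aeval_fin_two_mem hP isMulFiltration_degree.X_mem (add_mem ?_ ?_)
  · exact C_mem_coeffFiltration isMulFiltration_triv.X_mem
  · rw [show C (C c) = algebraMap k k[X][X] c from rfl, ← Algebra.smul_def]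
    exact Submodule.smul_mem _ _ isMulFiltration_degree.X_mem

lemma eval_eval_shear (c e s : k) :
    ((shear c P).eval (C e)).eval s = MvPolynomial.aeval ![e, s + c * e] P := by
  rw [shear, aeval_eq_sum_support_fin_two, aeval_eq_sum_support_fin_two, eval_finsetSum,
    eval_finsetSum]
  simp [Algebra.smul_def]

lemma eval₂_shear (c : k) (x y : PowerSeries k) :
    (shear c P).eval₂ ((aeval (y - c • x) : k[X] →ₐ[k] PowerSeries k) : k[X] →+* PowerSeries k) x =
      MvPolynomial.aeval ![x, y] P := by
  rw [shear, aeval_eq_sum_support_fin_two, aeval_eq_sum_support_fin_two, eval₂_finsetSum]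
  refine Finset.sum_congr rfl fun m _ => ?_
  rw [Algebra.smul_def (P.coeff m) (_ : k[X][X]), eval₂_mul, eval₂_mul, eval₂_pow,
    eval₂_pow, eval₂_add, eval₂_mul, eval₂_X, eval₂_C, eval₂_C, show algebraMap k k[X][X] (P.coeff m) = C (C (P.coeff m)) from rfl,
    eval₂_C]
  simp [Algebra.smul_def]

lemma coeff_shear (hP : ∀ m ∈ P.support, m 0 + m 1 ≤ D) (c : k) :
    (shear c P).coeff D =
      C (∑ m ∈ P.support, P.coeff m * if m 0 + m 1 = D then c ^ m 1 else 0) := by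
  have h1 : (shear c P).coeff D = C (((shear c P).coeff D).coeff 0) := by
    refine eq_C_of_natDegree_eq_zero (Nat.le_zero.1 (natDegree_le_iff_coeff_eq_zero.2 ?_))
    exact fun j hj => coeff_eq_zero_of_mem_triv (shear_mem hP c D) (by push_cast; omega)
  rw [h1, coeff_zero_eq_eval_zero, shear, aeval_eq_sum_support_fin_two, finsetSum_coeff,
    eval_finsetSum]
  congr 1
  refine Finset.sum_congr rfl fun m hm => ?_
  have h2 : ∀ p : k[X][X], (p.coeff D).eval 0 = (p.map (evalRingHom (0 : k))).coeff D := by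
    intro p; rw [coeff_map]; rfl
  rw [h2, Algebra.smul_def, show algebraMap k k[X][X] (P.coeff m) = C (C (P.coeff m)) from rfl]
  simp only [Polynomial.map_mul, Polynomial.map_pow, Polynomial.map_add, map_X, map_C,
    coe_evalRingHom, eval_C, eval_X, map_zero, zero_add, coeff_C_mul, mul_pow]
  rw [← mul_assoc, mul_comm (X ^ m 0), mul_assoc, ← pow_add, ← C_pow, coeff_C_mul, coeff_X_pow]
  simp [eq_comm]

lemma exists_coeff_shear_ne_zero [Fintype k] (hP : ∀ m ∈ P.support, m 0 + m 1 ≤ D)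
    (htop : P.coeff (Finsupp.single 1 D) ≠ 0) (hD : D < Fintype.card k) :
    ∃ c γ : k, γ ≠ 0 ∧ (shear c P).coeff D = C γ := by
  classical
  let Γ : k[X] := ∑ m ∈ P.support, C (P.coeff m) * if m 0 + m 1 = D then X ^ m 1 else 0
  have hcoeff : Γ.coeff D = P.coeff (Finsupp.single 1 D) := by
    rw [finsetSum_coeff, Finset.sum_eq_single (Finsupp.single (1 : Fin 2) D)]
    · simp
    · intro m hm hne
      rw [coeff_C_mul]
      split_ifs with h
      · rw [coeff_X_pow, if_neg, mul_zero]
        intro h1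
        refine hne (Finsupp.ext fun i => ?_)
        fin_cases i
        · simp; omega
        · simp; omega
      · simp
    · simp
  have hdeg : Γ.natDegree ≤ D := by
    refine natDegree_sum_le_of_forall_le _ _ fun m hm => ?_
    refine (natDegree_C_mul_le _ _).trans ?_
    split_ifs with h
    · rw [natDegree_X_pow]; omega
    · simp
  have hΓ : Γ ≠ 0 := by
    intro h0
    rw [h0, coeff_zero] at hcoeff
    exact htop hcoeff.symm
  obtain ⟨c, hc⟩ := exists_eval_ne_zero_of_natDegree_lt_card Γ hΓ (by
    rw [Cardinal.mk_fintype]; exact_mod_cast hdeg.trans_lt hD)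
  refine ⟨c, _, ?_, coeff_shear hP c⟩
  convert hc using 1
  rw [eval_finsetSum]
  refine Finset.sum_congr rfl fun m _ => ?_
  split_ifs <;> simp

lemma natDegree_aeval_le (hP : ∀ m ∈ P.support, m 0 + m 1 ≤ D) {x y : k[X]}
    (hx : x ∈ degreeFiltration k 1) (hy : y ∈ degreeFiltration k 1) :
    (MvPolynomial.aeval ![x, y] P).natDegree ≤ D :=
  natDegree_le_iff_coeff_eq_zero.2 fun _ hj => coeff_eq_zero_of_mem_triv
    (isMulFiltration_degree.aeval_fin_two_mem hP hx hy) (by exact_mod_cast hj)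

lemma aeval_C_X_ne_zero (hP : ∀ m ∈ P.support, m 0 + m 1 ≤ D)
    (htop : P.coeff (Finsupp.single 1 D) ≠ 0) (e : k) :
    (MvPolynomial.aeval ![C e, X] P : k[X]) ≠ 0 := by
  intro h
  refine htop ?_
  have := congrArg (coeff · D) h
  simp only [aeval_eq_sum_support_fin_two, finsetSum_coeff, coeff_smul, ← C_pow, coeff_C_mul,
    coeff_X_pow, coeff_zero] at this
  rw [Finset.sum_eq_single (Finsupp.single (1 : Fin 2) D)] at this
  · simpa using this
  · intro m hm hne
    have := hP m hm
    rw [if_neg, mul_zero, smul_zero]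
    intro h1
    refine hne (Finsupp.ext fun i => ?_)
    fin_cases i
    · simp; omega
    · simp; omega
  · intro h2
    simp [MvPolynomial.notMem_support_iff.1 h2]

/-- A plane curve over a finite field of large size without rational points off three lines has
no smooth rational branch tangent to the first axis at the origin. -/
theorem false_of_plane_branch [Fintype k] (hP : ∀ m ∈ P.support, m 0 + m 1 ≤ D)
    (htop : P.coeff (Finsupp.single 1 D) ≠ 0) (hD : (D + 2) ^ 4 ≤ Fintype.card k)
    (haxis : (MvPolynomial.aeval ![X, 0] P : k[X]) ≠ 0)
    (hzero : ∀ a b : k, a ≠ 0 → a ≠ 1 → b ≠ 0 → MvPolynomial.aeval ![a, b] P ≠ 0)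
    {x : PowerSeries k} (hx₀ : PowerSeries.coeff 0 x = 0) (hx₁ : PowerSeries.coeff 1 x = 0)
    (hx : MvPolynomial.aeval ![x, PowerSeries.X] P = 0) : False := by
  classical
  have hDq : D < Fintype.card k := by
    refine lt_of_lt_of_le ?_ hD
    exact (by omega : D < D + 2).trans_le (Nat.le_self_pow (by norm_num) _)
  obtain ⟨c, γ, hγ, hcoeff⟩ := exists_coeff_shear_ne_zero hP htop hDq
  set G : k[X][X] := C (C γ⁻¹) * shear c P with hGdef
  have hGF : G ∈ coeffFiltration (degreeFiltration k) 1 D := by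
    rw [hGdef, show C (C γ⁻¹) = algebraMap k k[X][X] γ⁻¹ from rfl, ← Algebra.smul_def]
    exact Submodule.smul_mem _ _ (shear_mem hP c)
  have hGle : G.natDegree ≤ D := by
    refine natDegree_le_iff_coeff_eq_zero.2 fun i hi => Polynomial.ext fun j => ?_
    exact coeff_eq_zero_of_mem_triv (hGF i) (by push_cast; omega)
  have hGD : G.coeff D = 1 := by
    rw [hGdef, coeff_C_mul, hcoeff, ← C_mul, inv_mul_cancel₀ hγ, C_1]
  have hG : G.Monic := monic_of_natDegree_le_of_coeff_eq_one D hGle hGD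
  have hGdeg : G.natDegree = D :=
    le_antisymm hGle (le_natDegree_of_ne_zero (by rw [hGD]; exact one_ne_zero))
  let r₀ := (MvPolynomial.aeval ![C 0, X] P : k[X]).roots.toFinset
  let r₁ := (MvPolynomial.aeval ![C 1, X] P : k[X]).roots.toFinset
  let r₂ := (MvPolynomial.aeval ![X, 0] P : k[X]).roots.toFinset
  have hX : (X : k[X]) ∈ degreeFiltration k 1 := isMulFiltration_triv.X_mem
  have hC : ∀ e : k, (C e : k[X]) ∈ degreeFiltration k 1 := fun e =>
    isMulFiltration_degree.mono zero_le_one (isMulFiltration_degree.algebraMap_mem e)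
  have hcard : ∀ p : k[X], p.natDegree ≤ D → p.roots.toFinset.card ≤ D := fun p hp =>
    (Multiset.toFinset_card_le _).trans ((card_roots' p).trans hp)
  have hr₀ : r₀.card ≤ D := hcard _ (natDegree_aeval_le hP (hC 0) hX)
  have hr₁ : r₁.card ≤ D := hcard _ (natDegree_aeval_le hP (hC 1) hX)
  have hr₂ : r₂.card ≤ D := hcard _ (natDegree_aeval_le hP hX (zero_mem _))
  let bad : Finset k := r₀ ∪ r₁.image (fun s => s - c) ∪ r₂.image (fun s => -c * s)
  have hbad : bad.card ≤ 3 * D := by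
    refine (Finset.card_union_le _ _).trans ?_
    have := Finset.card_union_le r₀ (r₁.image (fun s => s - c))
    have := Finset.card_image_le (s := r₁) (f := fun s => s - c)
    have := Finset.card_image_le (s := r₂) (f := fun s => -c * s)
    omega
  have heval : ∀ (e : k) (a b : k[X]), (MvPolynomial.aeval ![a, b] P : k[X]).eval e =
      MvPolynomial.aeval ![a.eval e, b.eval e] P := by
    intro e a b
    rw [aeval_eq_sum_support_fin_two, aeval_eq_sum_support_fin_two, eval_finsetSum]
    simp
  have hsq := Nat.sqrt_le' (Fintype.card k)
  have hsq' : (D + 2) ^ 2 ≤ Nat.sqrt (Fintype.card k) := by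
    rw [Nat.le_sqrt']
    exact le_trans (by rw [← pow_mul]) hD
  refine false_of_branch hsq badᶜ ?_ (x := PowerSeries.X - c • x) (y := x) ?_ ?_ hG
    (hGdeg ▸ hGF) ?_ (hGdeg ▸ hsq') ?_
  · rw [← Finset.card_compl, compl_compl]
    refine le_trans (Nat.mul_le_mul_right _ ?_) (le_trans (le_of_eq (sq _).symm) hsq)
    have : 6 * D ≤ (D + 2) ^ 2 := by
      zify
      nlinarith [sq_nonneg ((D : ℤ) - 1)]
    omega
  · rw [PowerSeries.coeff_zero_eq_constantCoeff] at hx₀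
    simp [hx₀]
  · simp [hx₁]
  · rw [hGdef, eval₂_mul, eval₂_shear, hx, mul_zero]
  · intro s hs e h0
    rw [Finset.mem_compl] at hs
    rw [hGdef, eval_mul, eval_mul, eval_eval_shear, eval_C, eval_C] at h0
    have h1 := (mul_eq_zero.1 h0).resolve_left (inv_ne_zero hγ)
    refine hs ?_
    by_cases he₀ : e = 0
    · refine Finset.mem_union_left _ (Finset.mem_union_left _ ?_)
      rw [Multiset.mem_toFinset, mem_roots (aeval_C_X_ne_zero hP htop 0), IsRoot.def, heval]
      simpa [he₀] using h1
    by_cases he₁ : e = 1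
    · refine Finset.mem_union_left _ (Finset.mem_union_right _ ?_)
      refine Finset.mem_image.2 ⟨s + c, ?_, by ring⟩
      rw [Multiset.mem_toFinset, mem_roots (aeval_C_X_ne_zero hP htop 1), IsRoot.def, heval]
      simpa [he₁] using h1
    by_cases hb : s + c * e = 0
    · refine Finset.mem_union_right _ (Finset.mem_image.2 ⟨e, ?_, by linear_combination -hb⟩)
      rw [Multiset.mem_toFinset, mem_roots haxis, IsRoot.def, heval]
      simpa [hb] using h1
    · exact absurd h1 (hzero _ _ he₀ he₁ hb)

end Shear

end Polynomial

section PowerSeriesRoot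

variable {k : Type*} [Field k]

/-- A simple root of the reduction of an equation over `k⟦X⟧` which is linear modulo `X` lifts. -/
lemma PowerSeries.exists_root_of_linear (a : PowerSeries k) {b : k} (hb : b ≠ 0)
    (Ψ : Polynomial (PowerSeries k)) :
    ∃ w : PowerSeries k, a + PowerSeries.C b * w + PowerSeries.X * Ψ.eval w = 0 := by
  let step : PowerSeries k → PowerSeries k := fun w =>
    -(PowerSeries.C b⁻¹ * (a + PowerSeries.X * Ψ.eval w))
  have hstep : ∀ w, a + PowerSeries.C b * step w + PowerSeries.X * Ψ.eval w = 0 := by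
    intro w
    have : PowerSeries.C b * PowerSeries.C b⁻¹ = (1 : PowerSeries k) := by
      rw [← map_mul, mul_inv_cancel₀ hb, map_one]
    linear_combination (-a - PowerSeries.X * Ψ.eval w) * this
  have hcontr : ∀ (n : ℕ) (v w : PowerSeries k), PowerSeries.X ^ n ∣ v - w →
      PowerSeries.X ^ (n + 1) ∣ step v - step w := by
    intro n v w h
    have h1 : step v - step w =
        (PowerSeries.X * (Ψ.eval v - Ψ.eval w)) * -PowerSeries.C b⁻¹ := by
      simp only [step]; ring
    rw [h1, pow_succ']
    exact (mul_dvd_mul_left _ (h.trans (Polynomial.sub_dvd_eval_sub v w Ψ))).mul_right _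
  let s : ℕ → PowerSeries k := fun n => step^[n] 0
  have hs : ∀ n, s (n + 1) = step (s n) := fun n => Function.iterate_succ_apply' step n 0
  have hsucc : ∀ n, (PowerSeries.X : PowerSeries k) ^ n ∣ s (n + 1) - s n := by
    intro n
    induction n with
    | zero => simp
    | succ n ih => rw [hs (n + 1), hs n]; exact hcontr n _ _ (by rwa [← hs n])
  have hle : ∀ m n, m ≤ n → (PowerSeries.X : PowerSeries k) ^ m ∣ s n - s m := by
    intro m n hmn
    induction n, hmn using Nat.le_induction with
    | base => simp
    | succ n hmn ih =>
      have := dvd_add ((pow_dvd_pow _ hmn).trans (hsucc n)) ih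
      rwa [sub_add_sub_cancel] at this
  let w : PowerSeries k := PowerSeries.mk fun n => PowerSeries.coeff n (s (n + 1))
  have hw : ∀ n, (PowerSeries.X : PowerSeries k) ^ n ∣ w - s n := by
    intro n
    rw [PowerSeries.X_pow_dvd_iff]
    intro m hm
    have := PowerSeries.X_pow_dvd_iff.1 (hle (m + 1) n hm) m (Nat.lt_succ_self m)
    rw [map_sub] at this ⊢
    rw [PowerSeries.coeff_mk]
    linear_combination -this
  refine ⟨w, ?_⟩
  have hfix : step w = w := by
    rw [← sub_eq_zero]
    ext n
    have h1 := dvd_sub (hcontr n _ _ (hw n)) (hs n ▸ hw (n + 1))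
    rw [sub_sub_sub_cancel_right] at h1
    exact PowerSeries.X_pow_dvd_iff.1 h1 n (Nat.lt_succ_self n)
  have := hstep w
  rwa [hfix] at this

end PowerSeriesRoot

namespace Polynomial

variable {k : Type*} [Field k] {P : MvPolynomial (Fin 2) k}

lemma exists_branch_of_edge {S N : ℕ} (hS : S ≤ N)
    (hge : ∀ m ∈ P.support, N ≤ S * m 0 + m 1)
    (hedge : ∀ m ∈ P.support, S * m 0 + m 1 = N → m 0 ≤ 1)
    (hcoeff : P.coeff (Finsupp.single 0 1 + Finsupp.single 1 (N - S)) ≠ 0) :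
    ∃ w : PowerSeries k,
      MvPolynomial.aeval ![w * PowerSeries.X ^ S, PowerSeries.X] P = 0 := by
  classical
  set m₁ : Fin 2 →₀ ℕ := Finsupp.single 0 1 + Finsupp.single 1 (N - S) with hm₁
  have hm₁0 : m₁ 0 = 1 := by simp [hm₁]
  have hm₁1 : m₁ 1 = N - S := by simp [hm₁]
  let e : (Fin 2 →₀ ℕ) → ℕ := fun m => S * m 0 + m 1 - N
  have hmem : m₁ ∈ P.support := MvPolynomial.mem_support_iff.2 hcoeff
  let a : PowerSeries k := ∑ m ∈ P.support.erase m₁,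
    if e m = 0 then PowerSeries.C (P.coeff m) else 0
  let Ψ : Polynomial (PowerSeries k) := ∑ m ∈ P.support.erase m₁,
    if e m = 0 then 0 else C (PowerSeries.C (P.coeff m) * PowerSeries.X ^ (e m - 1)) * X ^ m 0
  obtain ⟨w, hw⟩ := PowerSeries.exists_root_of_linear a hcoeff Ψ
  refine ⟨w, ?_⟩
  have hkey : MvPolynomial.aeval ![w * PowerSeries.X ^ S, PowerSeries.X] P =
      PowerSeries.X ^ N * (a + PowerSeries.C (P.coeff m₁) * w + PowerSeries.X * Ψ.eval w) := by
    rw [aeval_eq_sum_support_fin_two, ← Finset.add_sum_erase _ _ hmem, hm₁0, hm₁1]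
    have h1 : ∀ m ∈ P.support.erase m₁, P.coeff m • ((w * PowerSeries.X ^ S) ^ m 0 *
        PowerSeries.X ^ m 1) = PowerSeries.X ^ N * ((if e m = 0 then PowerSeries.C (P.coeff m)
          else 0) + PowerSeries.X * (if e m = 0 then 0 else
            C (PowerSeries.C (P.coeff m) * PowerSeries.X ^ (e m - 1)) * X ^ m 0).eval w) := by
      intro m hm
      rw [Finset.mem_erase] at hm
      have h2 := hge m hm.2
      rw [PowerSeries.smul_eq_C_mul, mul_pow, ← pow_mul]
      split_ifs with h0
      · have h3 : S * m 0 + m 1 = N := by simp only [e] at h0; omega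
        have h4 : m 0 = 0 := by
          have h5 := hedge m hm.2 h3
          by_contra h6
          have h7 : m 0 = 1 := by omega
          refine hm.1 (Finsupp.ext fun i => ?_)
          rw [h7] at h3
          fin_cases i
          · simpa [hm₁0] using h7
          · simp [hm₁1]; omega
        rw [h4, mul_zero, zero_add] at h3
        rw [h4, h3]
        simp
        ring
      · have h3 : S * m 0 + m 1 = N + 1 + (e m - 1) := by simp only [e] at h0 ⊢; omega
        rw [mul_assoc, ← pow_add, h3]
        simp only [eval_mul, eval_C, eval_pow, eval_X]
        ring
    rw [Finset.sum_congr rfl h1, ← Finset.mul_sum, Finset.sum_add_distrib, ← Finset.mul_sum]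
    simp only [a, Ψ, eval_finsetSum]
    rw [PowerSeries.smul_eq_C_mul, pow_one, mul_assoc, ← pow_add, Nat.add_sub_cancel' hS]
    ring
  rw [hkey, hw, mul_zero]

/-- A plane curve over a finite field of large size without rational points off three lines has no
edge of the Newton polygon as below. -/
theorem false_of_edge [Fintype k] {D S N : ℕ} (hP : ∀ m ∈ P.support, m 0 + m 1 ≤ D)
    (htop : P.coeff (Finsupp.single 1 D) ≠ 0) (hD : (D + 2) ^ 4 ≤ Fintype.card k)
    (haxis : (MvPolynomial.aeval ![X, 0] P : k[X]) ≠ 0)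
    (hzero : ∀ a b : k, a ≠ 0 → a ≠ 1 → b ≠ 0 → MvPolynomial.aeval ![a, b] P ≠ 0)
    (hS : 2 ≤ S) (hSN : S ≤ N)
    (hge : ∀ m ∈ P.support, N ≤ S * m 0 + m 1)
    (hedge : ∀ m ∈ P.support, S * m 0 + m 1 = N → m 0 ≤ 1)
    (hcoeff : P.coeff (Finsupp.single 0 1 + Finsupp.single 1 (N - S)) ≠ 0) : False := by
  obtain ⟨w, hw⟩ := exists_branch_of_edge hSN hge hedge hcoeff
  refine false_of_plane_branch hP htop hD haxis hzero ?_ ?_ hw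
  all_goals
    rw [PowerSeries.coeff_mul_X_pow', if_neg (by omega)]

end Polynomial

section PlanarCurve

variable {K : Type*} [Field K]

/-- The coefficient `binom(i - 1, k) + 1`. -/
def shiftedChoose (K : Type*) [Field K] (i k : ℕ) : K := (((i - 1).choose k + 1 : ℕ) : K)

section CharTwo

variable [CharP K 2]

lemma cast_choose_two_pow_mul (v o k : ℕ) :
    (((2 ^ v * o).choose k : ℕ) : K) =
      if 2 ^ v ∣ k then ((o.choose (k / 2 ^ v) : ℕ) : K) else 0 := by
  have h1 : (1 + Polynomial.X : Polynomial K) ^ (2 ^ v * o) =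
      Polynomial.expand K (2 ^ v) ((1 + Polynomial.X) ^ o) := by
    have := add_pow_char_pow (R := Polynomial K) (p := 2) (n := v) 1 Polynomial.X
    rw [pow_mul, this, one_pow]
    simp
  rw [← Polynomial.coeff_one_add_X_pow, h1, Polynomial.coeff_expand (by positivity),
    Polynomial.coeff_one_add_X_pow]

lemma shiftedChoose_succ {i : ℕ} (hi : 1 ≤ i) (k : ℕ) :
    shiftedChoose K i (k + 1) = ((i.choose (k + 1) : ℕ) : K) + shiftedChoose K i k := by
  obtain ⟨i, rfl⟩ := Nat.exists_eq_add_of_le' hi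
  rw [shiftedChoose, shiftedChoose, Nat.add_sub_cancel, Nat.choose_succ_succ]
  push_cast
  linear_combination -CharTwo.add_self_eq_zero ((i.choose k : ℕ) : K)

lemma shiftedChoose_zero (i : ℕ) : shiftedChoose K i 0 = 0 := by
  rw [shiftedChoose, Nat.choose_zero_right]
  exact CharP.cast_eq_zero K 2

lemma shiftedChoose_self_sub_one (i : ℕ) : shiftedChoose K i (i - 1) = 0 := by
  rw [shiftedChoose, Nat.choose_self]
  exact CharP.cast_eq_zero K 2

lemma shiftedChoose_eq_zero {v o k : ℕ} (ho : 1 ≤ o) (hk : k < 2 ^ v) :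
    shiftedChoose K (2 ^ v * o) k = 0 := by
  induction k with
  | zero => exact shiftedChoose_zero _
  | succ k ih =>
    rw [shiftedChoose_succ (Nat.mul_pos (by positivity) ho), ih (by omega),
      cast_choose_two_pow_mul, if_neg, add_zero]
    exact Nat.not_dvd_of_pos_of_lt (Nat.succ_pos k) hk

lemma shiftedChoose_two_pow {v o : ℕ} (ho : Odd o) : shiftedChoose K (2 ^ v * o) (2 ^ v) = 1 := by
  obtain ⟨j, hj⟩ := Nat.exists_eq_add_of_le' (Nat.one_le_two_pow (n := v))
  have h1 := shiftedChoose_succ (K := K) (Nat.mul_pos (Nat.two_pow_pos v) ho.pos) j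
  have hz : shiftedChoose K (2 ^ v * o) j = 0 := shiftedChoose_eq_zero ho.pos (by omega)
  rw [hz, ← hj, cast_choose_two_pow_mul, if_pos dvd_rfl, Nat.div_self (by positivity),
    Nat.choose_one_right, add_zero] at h1
  rw [h1]
  obtain ⟨r, rfl⟩ := ho
  push_cast
  rw [CharTwo.two_eq_zero, zero_mul, zero_add]

lemma one_add_mul_sum_shiftedChoose {T : Type*} [CommRing T] [Algebra K T] {i : ℕ} (hi : 1 ≤ i)
    (a : T) : (1 + a) * ∑ k ∈ Finset.range i, algebraMap K T (shiftedChoose K i k) * a ^ k =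
      1 + a ^ i + (1 + a) ^ i := by
  have h2 : (2 : T) = 0 := by
    rw [← map_ofNat (algebraMap K T) 2, CharTwo.two_eq_zero, map_zero]
  obtain ⟨i, rfl⟩ := Nat.exists_eq_add_of_le' hi
  have h3 : ∑ k ∈ Finset.range (i + 1), algebraMap K T (shiftedChoose K (i + 1) k) * a ^ k =
      (1 + a) ^ i + ∑ k ∈ Finset.range (i + 1), a ^ k := by
    rw [add_comm 1 a, add_pow, ← Finset.sum_add_distrib]
    refine Finset.sum_congr rfl fun k _ => ?_
    simp [shiftedChoose]
    ring
  have h4 := geom_sum_mul a (i + 1)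
  rw [h3]
  linear_combination h4 + h2 * (∑ k ∈ Finset.range (i + 1), a ^ k - 1)

end CharTwo

/-- The exponent of `X ^ a * Y ^ b`. -/
def planeExponent (a b : ℕ) : Fin 2 →₀ ℕ := Finsupp.single 0 a + Finsupp.single 1 b

@[simp] lemma planeExponent_zero (a b : ℕ) : planeExponent a b 0 = a := by simp [planeExponent]

@[simp] lemma planeExponent_one (a b : ℕ) : planeExponent a b 1 = b := by simp [planeExponent]

lemma planeExponent_inj {a b a' b' : ℕ} :
    planeExponent a b = planeExponent a' b' ↔ a = a' ∧ b = b' := by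
  refine ⟨fun h => ⟨?_, ?_⟩, fun h => by rw [h.1, h.2]⟩
  · simpa using DFunLike.congr_fun h 0
  · simpa using DFunLike.congr_fun h 1

lemma eq_planeExponent (m : Fin 2 →₀ ℕ) : m = planeExponent (m 0) (m 1) := by
  ext i
  fin_cases i <;> simp

/-- The plane curve attached to a polynomial, with the powers of the first variable shifted down
by `κ`. -/
def planarCurve (f : Polynomial K) (d κ : ℕ) : MvPolynomial (Fin 2) K :=
  monomial (planeExponent 0 (d - 2)) 1 + ∑ i ∈ Finset.Icc 3 d, ∑ k ∈ Finset.Ico 1 i,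
    monomial (planeExponent (k - κ) (d - i)) (f.coeff i * shiftedChoose K i k)

lemma coeff_planarCurve (f : Polynomial K) (d κ a b : ℕ) :
    (planarCurve f d κ).coeff (planeExponent a b) = (if a = 0 ∧ b = d - 2 then 1 else 0) +
      ∑ i ∈ Finset.Icc 3 d, ∑ k ∈ Finset.Ico 1 i,
        if k - κ = a ∧ d - i = b then f.coeff i * shiftedChoose K i k else 0 := by
  simp only [planarCurve, coeff_add, coeff_sum, coeff_monomial, planeExponent_inj]
  simp only [eq_comm]

lemma coeff_planarCurve_top {f : Polynomial K} {d κ : ℕ} (hd : 3 ≤ d) :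
    (planarCurve f d κ).coeff (planeExponent 0 (d - 2)) = 1 := by
  rw [coeff_planarCurve, if_pos ⟨rfl, rfl⟩, Finset.sum_eq_zero, add_zero]
  intro i hi
  rw [Finset.mem_Icc] at hi
  exact Finset.sum_eq_zero fun k _ => if_neg (by omega)

lemma coeff_planarCurve_of_mem {f : Polynomial K} {d κ i k : ℕ} (hκ : κ ≤ 1) (hi : 3 ≤ i)
    (hid : i ≤ d) (hk : 1 ≤ k) (hki : k < i) :
    (planarCurve f d κ).coeff (planeExponent (k - κ) (d - i)) =
      f.coeff i * shiftedChoose K i k := by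
  rw [coeff_planarCurve, if_neg (by omega), zero_add,
    Finset.sum_eq_single_of_mem i (Finset.mem_Icc.2 ⟨hi, hid⟩),
    Finset.sum_eq_single_of_mem k (Finset.mem_Ico.2 ⟨hk, hki⟩), if_pos ⟨rfl, rfl⟩]
  · intro l hl hlk
    rw [Finset.mem_Ico] at hl
    exact if_neg (by omega)
  · intro j hj hji
    rw [Finset.mem_Icc] at hj
    exact Finset.sum_eq_zero fun l _ => if_neg (by omega)

lemma eq_or_exists_of_coeff_planarCurve_ne_zero {f : Polynomial K} {d κ a b : ℕ}
    (h : (planarCurve f d κ).coeff (planeExponent a b) ≠ 0) :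
    (a = 0 ∧ b = d - 2) ∨ ∃ i k, 3 ≤ i ∧ i ≤ d ∧ 1 ≤ k ∧ k < i ∧
      f.coeff i * shiftedChoose K i k ≠ 0 ∧ k - κ = a ∧ d - i = b := by
  by_cases h0 : a = 0 ∧ b = d - 2
  · exact Or.inl h0
  rw [coeff_planarCurve, if_neg h0, zero_add] at h
  obtain ⟨i, hi, h1⟩ := Finset.exists_ne_zero_of_sum_ne_zero h
  obtain ⟨k, hk, h2⟩ := Finset.exists_ne_zero_of_sum_ne_zero h1
  rw [ne_eq, ite_eq_right_iff, Classical.not_imp] at h2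
  rw [Finset.mem_Icc] at hi
  rw [Finset.mem_Ico] at hk
  exact Or.inr ⟨i, k, hi.1, hi.2, hk.1, hk.2, h2.2, h2.1.1, h2.1.2⟩

lemma aeval_monomial_planeExponent {T : Type*} [CommRing T] [Algebra K T] (a b : T) (j l : ℕ)
    (c : K) : aeval ![a, b] (monomial (planeExponent j l) c) =
      algebraMap K T c * (a ^ j * b ^ l) := by
  rw [aeval_monomial, Finsupp.prod_fintype _ _ (fun _ => pow_zero _), Fin.prod_univ_two]
  simp

lemma aeval_planarCurve {T : Type*} [CommRing T] [Algebra K T] (f : Polynomial K) (d κ : ℕ)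
    (a b : T) : aeval ![a, b] (planarCurve f d κ) = b ^ (d - 2) +
      ∑ i ∈ Finset.Icc 3 d, ∑ k ∈ Finset.Ico 1 i,
        algebraMap K T (f.coeff i * shiftedChoose K i k) * (a ^ (k - κ) * b ^ (d - i)) := by
  simp only [planarCurve, map_add, map_sum, aeval_monomial_planeExponent, map_one, one_mul,
    pow_zero]

lemma eval_eq_coeff_zero_add_sum {f : Polynomial K} {d : ℕ} (hd : f.natDegree = d) (hd3 : 3 ≤ d)
    (h1 : f.coeff 1 = 0) (h2 : f.coeff 2 = 0) (x : K) :
    f.eval x = f.coeff 0 + ∑ i ∈ Finset.Icc 3 d, f.coeff i * x ^ i := by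
  have h3 : Finset.Icc 3 d = Finset.Ico 3 (d + 1) := by
    ext
    simp
  rw [Polynomial.eval_eq_sum_range, hd, h3, ← Finset.sum_range_add_sum_Ico _ (by omega : 3 ≤ d + 1)]
  simp [Finset.sum_range_succ, h1, h2]

section CharTwo

variable [CharP K 2]

lemma aeval_planarCurve_ne_zero {f : Polynomial K} {d κ : ℕ} (hd : f.natDegree = d) (hd3 : 3 ≤ d)
    (h1 : f.coeff 1 = 0) (h2 : f.coeff 2 = 0)
    (hinj : ∀ ε : K, ε ≠ 0 → Function.Injective fun x : K => f.eval (x + ε) + f.eval x + ε * x)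
    (hκ : κ ≤ 1) {a b : K} (ha : a ≠ 0) (ha1 : a ≠ 1) (hb : b ≠ 0) :
    aeval ![a, b] (planarCurve f d κ) ≠ 0 := by
  intro h
  have hz : (1 + a) / b ≠ 0 := by
    refine div_ne_zero (fun h => ha1 ?_) hb
    exact (CharTwo.add_eq_zero.1 h).symm
  have hsum : a ^ κ * b ^ (d - 2) + ∑ i ∈ Finset.Icc 3 d, f.coeff i * b ^ (d - i) *
      ∑ k ∈ Finset.range i, shiftedChoose K i k * a ^ k = 0 := by
    rw [aeval_planarCurve] at h
    rw [← mul_zero (a ^ κ), ← h, mul_add, Finset.mul_sum]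
    congr 1
    refine Finset.sum_congr rfl fun i hi => ?_
    rw [Finset.mem_Icc] at hi
    rw [← Finset.sum_range_add_sum_Ico _ (by omega : 1 ≤ i), Finset.sum_range_one,
      shiftedChoose_zero, zero_mul, zero_add, Finset.mul_sum, Finset.mul_sum]
    refine Finset.sum_congr rfl fun k hk => ?_
    rw [Finset.mem_Ico] at hk
    have : a ^ k = a ^ κ * a ^ (k - κ) := by rw [← pow_add]; congr 1; omega
    rw [this, Algebra.algebraMap_self, RingHom.id_apply]
    ring
  have hone : (1 + a) * a ^ κ / b ^ 2 + (f.eval (1 / b) + f.eval (a / b) + f.eval ((1 + a) / b) +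
      f.eval 0) = 0 := by
    have key : ∀ i ∈ Finset.Icc 3 d, f.coeff i * (1 / b) ^ i + f.coeff i * (a / b) ^ i +
        f.coeff i * ((1 + a) / b) ^ i = (1 + a) / b ^ d * (f.coeff i * b ^ (d - i) *
          ∑ k ∈ Finset.range i, shiftedChoose K i k * a ^ k) := by
      intro i hi
      rw [Finset.mem_Icc] at hi
      have h3 := one_add_mul_sum_shiftedChoose (K := K) (i := i) (by omega) a
      rw [Algebra.algebraMap_self] at h3
      simp only [RingHom.id_apply] at h3
      have h4 : b ^ d = b ^ (d - i) * b ^ i := by rw [← pow_add]; congr 1; omega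
      have h5 := pow_ne_zero (d - i) hb
      have h6 := pow_ne_zero i hb
      calc _ = f.coeff i * (1 + a ^ i + (1 + a) ^ i) / b ^ i := by
            simp only [div_pow, one_pow]
            ring
        _ = _ := by
            rw [← h3, h4]
            field_simp
    have hzero : ∑ i ∈ Finset.Icc 3 d, f.coeff i * (0 : K) ^ i = 0 :=
      Finset.sum_eq_zero fun i hi => by
        rw [Finset.mem_Icc] at hi
        rw [zero_pow (by omega), mul_zero]
    have hpow : b ^ d = b ^ (d - 2) * b ^ 2 := by rw [← pow_add]; congr 1; omega
    have h5 := pow_ne_zero (d - 2) hb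
    have h6 : (1 + a) * a ^ κ / b ^ 2 = (1 + a) / b ^ d * (a ^ κ * b ^ (d - 2)) := by
      rw [hpow]
      field_simp
    have h7 := Finset.sum_congr rfl key
    rw [Finset.sum_add_distrib, Finset.sum_add_distrib, ← Finset.mul_sum] at h7
    simp only [eval_eq_coeff_zero_add_sum hd hd3 h1 h2]
    rw [hzero, h6]
    linear_combination h7 + (1 + a) / b ^ d * hsum + 2 * f.coeff 0 * CharTwo.two_eq_zero (R := K)
  obtain ⟨ε, hε, hεz, hε'⟩ : ∃ ε : K, ε ≠ 0 ∧ ε * ((1 + a) / b) = (1 + a) * a ^ κ / b ^ 2 ∧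
      f.eval ((1 + a) / b + ε) + f.eval ε = f.eval (1 / b) + f.eval (a / b) := by
    have h2 : (2 : K) = 0 := CharTwo.two_eq_zero
    interval_cases κ
    · refine ⟨1 / b, one_div_ne_zero hb, by field_simp, ?_⟩
      rw [show (1 + a) / b + 1 / b = a / b by field_simp; linear_combination h2, add_comm]
    · refine ⟨a / b, div_ne_zero ha hb, by field_simp, ?_⟩
      rw [show (1 + a) / b + a / b = 1 / b by field_simp; linear_combination a * h2]
  refine hz (hinj ε hε ?_)
  simp only [zero_add, mul_zero, add_zero]
  rw [hεz]
  linear_combination hone + hε' - (f.eval ε + f.eval 0) * CharTwo.two_eq_zero (R := K)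

lemma aeval_planarCurve_axis_ne_zero {f : Polynomial K} {d κ : ℕ} (hd3 : 3 ≤ d)
    (hAd : f.coeff d ≠ 0) (h2pow : ∀ k, d ≠ 2 ^ k) (hκ : κ ≤ 1) :
    (aeval ![Polynomial.X, 0] (planarCurve f d κ) : Polynomial K) ≠ 0 := by
  obtain ⟨v, o, ho, rfl⟩ := Nat.exists_eq_two_pow_mul_odd (by omega : d ≠ 0)
  have hpos := Nat.two_pow_pos v
  have hlt : 2 ^ v < 2 ^ v * o := by
    refine lt_of_le_of_ne (Nat.le_mul_of_pos_right _ ho.pos) fun h => h2pow v h.symm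
  intro h
  have h1 := congrArg (fun p => Polynomial.coeff p (2 ^ v - κ)) h
  simp only [aeval_planarCurve] at h1
  rw [zero_pow (by omega), zero_add, Finset.sum_eq_single_of_mem (2 ^ v * o)
    (Finset.mem_Icc.2 ⟨hd3, le_rfl⟩), Polynomial.finsetSum_coeff,
    Finset.sum_eq_single_of_mem (2 ^ v) (Finset.mem_Ico.2 ⟨hpos, hlt⟩)] at h1
  · simp [shiftedChoose_two_pow ho, Polynomial.algebraMap_eq, hAd] at h1
  · intro k hk hkv
    rw [Finset.mem_Ico] at hk
    rw [Nat.sub_self, pow_zero, mul_one, Polynomial.algebraMap_eq, Polynomial.coeff_C_mul,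
      Polynomial.coeff_X_pow, if_neg (by omega), mul_zero]
  · intro i hi hid
    rw [Finset.mem_Icc] at hi
    refine Finset.sum_eq_zero fun k _ => ?_
    rw [zero_pow (by omega), mul_zero, mul_zero]

lemma degree_le_of_mem_support_planarCurve {f : Polynomial K} {d κ : ℕ} {m : Fin 2 →₀ ℕ}
    (hm : m ∈ (planarCurve f d κ).support) : m 0 + m 1 ≤ d - 2 := by
  rw [mem_support_iff, eq_planeExponent m] at hm
  obtain h | ⟨i, k, h3, hid, h1, hki, hne, h4, h5⟩ :=
    eq_or_exists_of_coeff_planarCurve_ne_zero hm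
  · omega
  · have : k ≠ i - 1 := by
      rintro rfl
      exact hne (by rw [shiftedChoose_self_sub_one, mul_zero])
    omega

/-- The curve of a planar polynomial of small degree has no edge of slope `-S` carrying a single
monomial in each of the columns `0` and `1`. -/
lemma false_of_planarCurve_edge [Fintype K] {f : Polynomial K} {d κ : ℕ}
    (hd : f.natDegree = d) (hd3 : 3 ≤ d) (hAd : f.coeff d ≠ 0) (hdeg : d ^ 4 ≤ Fintype.card K)
    (h2pow : ∀ k, f.coeff (2 ^ k) = 0)
    (hinj : ∀ ε : K, ε ≠ 0 → Function.Injective fun x : K => f.eval (x + ε) + f.eval x + ε * x)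
    (hκ : κ ≤ 1) {S N i : ℕ} (hS : 2 ≤ S) (hN : N ≤ d - 2)
    (hi : i + N = d + S)
    (hne : f.coeff i * shiftedChoose K i (κ + 1) ≠ 0) (hiκ : κ + 1 < i) (hi3 : 3 ≤ i) (hid : i ≤ d)
    (hge : ∀ j k, 3 ≤ j → j ≤ d → 1 ≤ k → k < j → f.coeff j * shiftedChoose K j k ≠ 0 →
      N + j ≤ S * (k - κ) + d)
    (hgt : ∀ j k, 3 ≤ j → j ≤ d → κ + 2 ≤ k → k < j → f.coeff j * shiftedChoose K j k ≠ 0 →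
      N + j < S * (k - κ) + d) : False := by
  have hsingle : ∀ b, planeExponent 0 b = Finsupp.single 1 b := fun b => by simp [planeExponent]
  refine Polynomial.false_of_edge (P := planarCurve f d κ) (D := d - 2) (S := S) (N := N)
    (fun m hm => degree_le_of_mem_support_planarCurve hm) ?_ ?_
    (aeval_planarCurve_axis_ne_zero hd3 hAd ?_ hκ)
    (fun a b ha ha1 hb => aeval_planarCurve_ne_zero hd hd3 ?_ ?_ hinj hκ ha ha1 hb)
    hS (by omega) ?_ ?_ ?_
  · rw [← hsingle, coeff_planarCurve_top hd3]
    exact one_ne_zero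
  · rwa [Nat.sub_add_cancel (by omega)]
  · intro k hk
    exact hAd (hk ▸ h2pow k)
  · exact h2pow 0
  · exact h2pow 1
  · intro m hm
    rw [mem_support_iff, eq_planeExponent m] at hm
    obtain h | ⟨j, k, h3, hjd, h1, hkj, hne', h4, h5⟩ :=
      eq_or_exists_of_coeff_planarCurve_ne_zero hm
    · rw [h.1, h.2]
      omega
    · have := hge j k h3 hjd h1 hkj hne'
      rw [h4] at this
      omega
  · intro m hm hmN
    rw [mem_support_iff, eq_planeExponent m] at hm
    obtain h | ⟨j, k, h3, hjd, h1, hkj, hne', h4, h5⟩ :=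
      eq_or_exists_of_coeff_planarCurve_ne_zero hm
    · omega
    · by_contra hm0
      have := hgt j k h3 hjd (by omega) hkj hne'
      rw [h4] at this
      omega
  · have := coeff_planarCurve_of_mem (f := f) hκ hi3 hid (Nat.le_add_left 1 κ) hiκ
    rw [show κ + 1 - κ = 1 by omega, show d - i = N - S by omega] at this
    exact fun h => hne (this.symm.trans h)

end CharTwo

section CharTwo

variable [CharP K 2]

lemma eq_one_or_two_of_eq_mul_add_two {f : Polynomial K} {d T : ℕ} (hT : 2 ≤ T)
    (h2pow : ∀ k, f.coeff (2 ^ k) = 0)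
    (hle : ∀ i k, 3 ≤ i → i ≤ d → 1 ≤ k → k < i → f.coeff i * shiftedChoose K i k ≠ 0 →
      i ≤ T * k + 2)
    {i k : ℕ} (hi3 : 3 ≤ i) (hid : i ≤ d) (hne : f.coeff i * shiftedChoose K i k ≠ 0)
    (heq : i = T * k + 2) : (k = 1 ∧ Odd T) ∨ (k = 2 ∧ Even T) := by
  obtain ⟨v, o, ho, hio⟩ := Nat.exists_eq_two_pow_mul_odd (by omega : i ≠ 0)
  have hvk : 2 ^ v ≤ k := by
    by_contra! h
    rw [hio, shiftedChoose_eq_zero ho.pos h, mul_zero] at hne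
    exact hne rfl
  have hlt : 2 ^ v < i := by
    refine lt_of_le_of_ne (hio ▸ Nat.le_mul_of_pos_right _ ho.pos) fun h => ?_
    rw [← h, h2pow v, zero_mul] at hne
    exact hne rfl
  have h1 : i ≤ T * 2 ^ v + 2 := by
    refine hle i _ hi3 hid (Nat.two_pow_pos v) hlt ?_
    have h2 := shiftedChoose_two_pow (K := K) (v := v) ho
    rw [← hio] at h2
    rw [h2, mul_one]
    exact left_ne_zero_of_mul hne
  obtain rfl : k = 2 ^ v := by
    refine le_antisymm ?_ hvk
    have : T * k ≤ T * 2 ^ v := by omega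
    exact Nat.le_of_mul_le_mul_left this (by omega)
  have hdvd : 2 ^ v ∣ 2 := by
    have h2 : 2 ^ v ∣ T * 2 ^ v + 2 := heq ▸ hio ▸ Dvd.intro _ rfl
    exact (Nat.dvd_add_right (Dvd.intro_left _ rfl)).1 h2
  have h2 := Nat.le_of_dvd two_pos hdvd
  have h3 := Nat.two_pow_pos v
  obtain h4 | h4 : 2 ^ v = 1 ∨ 2 ^ v = 2 := by omega
  · refine Or.inl ⟨h4, ?_⟩
    obtain ⟨r, rfl⟩ := ho
    rw [h4] at hio heq
    exact ⟨r - 1, by omega⟩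
  · refine Or.inr ⟨h4, ?_⟩
    obtain ⟨r, rfl⟩ := ho
    rw [h4] at hio heq
    exact ⟨r, by omega⟩

/-- A planar polynomial of small degree has no term on the line `i = T * k + 2` when all its terms
lie on one side of that line. -/
lemma ne_mul_add_two_of_le [Fintype K] {f : Polynomial K} {d T : ℕ}
    (hd : f.natDegree = d) (hd3 : 3 ≤ d) (hAd : f.coeff d ≠ 0) (hdeg : d ^ 4 ≤ Fintype.card K)
    (h2pow : ∀ k, f.coeff (2 ^ k) = 0)
    (hinj : ∀ ε : K, ε ≠ 0 → Function.Injective fun x : K => f.eval (x + ε) + f.eval x + ε * x)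
    (hT : 2 ≤ T)
    (hle : ∀ i k, 3 ≤ i → i ≤ d → 1 ≤ k → k < i → f.coeff i * shiftedChoose K i k ≠ 0 →
      i ≤ T * k + 2)
    {i k : ℕ} (hi3 : 3 ≤ i) (hid : i ≤ d) (hki : k < i)
    (hne : f.coeff i * shiftedChoose K i k ≠ 0) : i ≠ T * k + 2 := by
  intro heq
  obtain ⟨rfl, hT'⟩ | ⟨rfl, hT'⟩ := eq_one_or_two_of_eq_mul_add_two hT h2pow hle hi3 hid hne heq
  · refine false_of_planarCurve_edge (κ := 0) (S := T) (N := d - 2) (i := i) hd hd3 hAd hdeg h2pow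
      hinj (by omega) hT le_rfl (by omega) hne (by omega) hi3 hid ?_ ?_
    · intro j k hj3 hjd hk hkj hne'
      have := hle j k hj3 hjd hk hkj hne'
      rw [Nat.sub_zero]
      omega
    · intro j k hj3 hjd hk hkj hne'
      have h1 := hle j k hj3 hjd (by omega) hkj hne'
      have h2 : j ≠ T * k + 2 := fun h => by
        obtain ⟨h3, -⟩ | ⟨-, h3⟩ := eq_one_or_two_of_eq_mul_add_two hT h2pow hle hj3 hjd hne' h
        · omega
        · exact Nat.not_even_iff_odd.2 hT' h3
      rw [Nat.sub_zero]
      omega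
  · refine false_of_planarCurve_edge (κ := 1) (S := T) (N := d - 2 - T) (i := i) hd hd3 hAd hdeg
      h2pow hinj le_rfl hT (by omega) (by omega) hne hki hi3 hid ?_ ?_
    all_goals
      intro j k hj3 hjd hk hkj hne'
      have h1 := hle j k hj3 hjd (by omega) hkj hne'
      have h2 : j = T * k + 2 → k = 1 ∨ k = 2 := fun h =>
        (eq_one_or_two_of_eq_mul_add_two hT h2pow hle hj3 hjd hne' h).imp And.left And.left
      have h3 : T * k = T * (k - 1) + T := by
        rw [← Nat.mul_succ, Nat.succ_eq_add_one, Nat.sub_add_cancel (by omega)]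
      omega

end CharTwo

section BlowUp

lemma coeff_mul_X_one_pow (P : MvPolynomial (Fin 2) K) (n a e : ℕ) :
    (P * X 1 ^ n).coeff (planeExponent a (e + n)) = P.coeff (planeExponent a e) := by
  rw [show planeExponent a (e + n) = planeExponent a e + Finsupp.single 1 n by
    simp [planeExponent, add_assoc], X_pow_eq_monomial, coeff_mul_monomial, mul_one]

lemma coeff_blowUp (P : MvPolynomial (Fin 2) K) (a c : ℕ) :
    (aeval ![X 0 * X 1, X 1] P : MvPolynomial (Fin 2) K).coeff (planeExponent a c) =
      if a ≤ c then P.coeff (planeExponent a (c - a)) else 0 := by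
  induction P using MvPolynomial.induction_on' with
  | monomial m r =>
    rw [eq_planeExponent m, aeval_monomial_planeExponent, algebraMap_eq, mul_pow, mul_assoc,
      ← pow_add, X_pow_eq_monomial, X_pow_eq_monomial, monomial_mul, C_mul_monomial,
      coeff_monomial, coeff_monomial, mul_one, mul_one]
    change (if planeExponent _ _ = _ then r else 0) = _
    simp only [planeExponent_inj]
    split_ifs <;> first | rfl | omega
  | add p q hp hq =>
    rw [map_add, coeff_add, hp, hq, coeff_add]
    split_ifs
    · rfl
    · rw [add_zero]

lemma coeff_tangentCone {P : MvPolynomial (Fin 2) K} {n : ℕ}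
    (hn : IsLeast {m : ℕ | ∃ s ∈ P.support, (s.sum fun _ e => e) = m} n) (a b : ℕ) :
    (tangentCone P).coeff (planeExponent a b) =
      if a + b = n then P.coeff (planeExponent a b) else 0 := by
  have h : (planeExponent a b).degree = a + b := by simp [planeExponent]
  rw [tangentCone, minMonomialDeg, hn.csInf_eq, coeff_homogeneousComponent, h]

lemma le_add_of_coeff_ne_zero {P : MvPolynomial (Fin 2) K} {n a b : ℕ}
    (hn : IsLeast {m : ℕ | ∃ s ∈ P.support, (s.sum fun _ e => e) = m} n)
    (h : P.coeff (planeExponent a b) ≠ 0) : n ≤ a + b := by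
  refine hn.2 ⟨_, mem_support_iff.2 h, ?_⟩
  rw [Finsupp.sum_fintype _ _ fun _ => rfl, Fin.sum_univ_two, planeExponent_zero, planeExponent_one]

lemma X_zero_dvd_iff {P : MvPolynomial (Fin 2) K} :
    X 0 ∣ P ↔ ∀ b, P.coeff (planeExponent 0 b) = 0 := by
  rw [X_dvd_iff_modMonomial_eq_zero]
  constructor
  · intro h b
    rw [← coeff_modMonomial_of_not_le P (s := Finsupp.single 0 1), h, coeff_zero]
    rw [Finsupp.single_le_iff]
    simp
  · intro h
    ext m
    rw [coeff_zero]
    by_cases hm : Finsupp.single 0 1 ≤ m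
    · exact coeff_modMonomial_of_le _ hm
    · rw [coeff_modMonomial_of_not_le _ hm, eq_planeExponent m]
      rw [Finsupp.single_le_iff] at hm
      rw [show m 0 = 0 by omega, h]

variable {F : ℕ → MvPolynomial (Fin 2) K} {nseq : ℕ → ℕ}

/-- The coefficients of the `r`-th iterated blow-up in terms of those of the original curve. -/
lemma coeff_iterated_blowUp (hnseq : ∀ r, 1 ≤ r →
      IsLeast {m : ℕ | ∃ s ∈ (F (r - 1)).support, (s.sum fun _ e => e) = m} (nseq r))
    (hF : ∀ r, 1 ≤ r →
      F r * (X 1 : MvPolynomial (Fin 2) K) ^ nseq r = aeval ![X 0 * X 1, X 1] (F (r - 1)))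
    (r : ℕ) :
    (∀ a b e, b + r * a = e + ∑ s ∈ Finset.range r, nseq (s + 1) →
      (F r).coeff (planeExponent a e) = (F 0).coeff (planeExponent a b)) ∧
    (∀ a e, (F r).coeff (planeExponent a e) ≠ 0 →
      r * a ≤ e + ∑ s ∈ Finset.range r, nseq (s + 1)) ∧
    (∀ a b, (F 0).coeff (planeExponent a b) ≠ 0 →
      ∑ s ∈ Finset.range r, nseq (s + 1) ≤ b + r * a) := by
  induction r with
  | zero => simp
  | succ r ih =>
    obtain ⟨ih1, ih2, ih3⟩ := ih
    have hstep : ∀ a e, (F (r + 1)).coeff (planeExponent a e) =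
        if a ≤ e + nseq (r + 1) then (F r).coeff (planeExponent a (e + nseq (r + 1) - a))
        else 0 := fun a e => by
      rw [← coeff_mul_X_one_pow (F (r + 1)) (nseq (r + 1)) a e, hF (r + 1) (by omega), coeff_blowUp,
        Nat.add_sub_cancel]
    have hmin : ∀ a e, (F r).coeff (planeExponent a e) ≠ 0 → nseq (r + 1) ≤ a + e :=
      fun a e => le_add_of_coeff_ne_zero (hnseq (r + 1) (by omega))
    simp only [Finset.sum_range_succ, Nat.succ_mul]
    refine ⟨fun a b e h => ?_, fun a e h => ?_, fun a b h => ?_⟩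
    · rw [hstep]
      split_ifs with hae
      · exact ih1 _ _ _ (by omega)
      · by_contra hne
        have := ih3 a b (Ne.symm hne)
        omega
    · rw [hstep] at h
      split_ifs at h with hae
      · have := ih2 _ _ h
        omega
      · exact absurd rfl h
    · have h1 := ih3 a b h
      have h2 := hmin a (b + r * a - ∑ s ∈ Finset.range r, nseq (s + 1))
        (by rwa [ih1 a b _ (by omega)])
      omega


lemma eq_planarCurve [CharP K 2] (f : Polynomial K) (d : ℕ) :
    (X 1 : MvPolynomial (Fin 2) K) ^ (d - 2) +
      ∑ i ∈ Finset.Icc 3 d, C (f.coeff i) * (X 1) ^ (d - i) *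
        ∑ k ∈ Finset.range i, C ((((i - 1).choose k + 1 : ℕ) : K)) * (X 0) ^ k =
      planarCurve f d 0 := by
  have hX : (X 1 : MvPolynomial (Fin 2) K) ^ (d - 2) = monomial (planeExponent 0 (d - 2)) 1 := by
    simp [planeExponent, X_pow_eq_monomial]
  rw [planarCurve, hX]
  congr 1
  refine Finset.sum_congr rfl fun i hi => ?_
  rw [Finset.mem_Icc] at hi
  change _ * ∑ k ∈ Finset.range i, C (shiftedChoose K i k) * _ = _
  rw [← Finset.sum_range_add_sum_Ico _ (by omega : 1 ≤ i), Finset.sum_range_one,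
    shiftedChoose_zero, C_0, zero_mul, zero_add, Finset.mul_sum]
  refine Finset.sum_congr rfl fun k _ => ?_
  rw [X_pow_eq_monomial, X_pow_eq_monomial, C_mul_monomial, C_mul_monomial, monomial_mul,
    mul_one, mul_one, add_comm, Nat.sub_zero, planeExponent]

end BlowUp

end PlanarCurve

theorem tangent_cone_Ft_eq
    {K : Type*} [Field K] [Fintype K] (n : ℕ) (hn : 1 ≤ n)
    (hcard : Fintype.card K = 2 ^ n)
    (f : Polynomial K) (d : ℕ) (hd : f.natDegree = d) (hd3 : 3 ≤ d)
    (hAd : f.coeff d ≠ 0)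
    (hdeg : d ^ 4 ≤ Fintype.card K)
    (h2pow : ∀ i k : ℕ, i = 2 ^ k → f.coeff i = 0)
    (hplanar : ∀ ε : K, ε ≠ 0 →
      Function.Bijective fun x : K => f.eval (x + ε) + f.eval x + ε * x)
    (F : ℕ → MvPolynomial (Fin 2) K) (nseq : ℕ → ℕ)
    (hF0 : F 0 = (X 1 : MvPolynomial (Fin 2) K) ^ (d - 2) +
      ∑ i ∈ Finset.Icc 3 d, C (f.coeff i) * (X 1) ^ (d - i) *
        ∑ k ∈ Finset.range i, C ((((i - 1).choose k + 1 : ℕ) : K)) * (X 0) ^ k)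
    (hnseq : ∀ r : ℕ, 1 ≤ r →
      IsLeast {m : ℕ | ∃ s ∈ (F (r - 1)).support, (s.sum fun _ e => e) = m} (nseq r))
    (hFr : ∀ r : ℕ, 1 ≤ r →
      F r * (X 1 : MvPolynomial (Fin 2) K) ^ (nseq r) = aeval ![X 0 * X 1, X 1] (F (r - 1)))
    (t : ℕ) (ht1 : 1 ≤ t)
    (ht : ¬ (X 0 : MvPolynomial (Fin 2) K) ∣ tangentCone (F t))
    (htleast : ∀ s : ℕ, s < t → (X 0 : MvPolynomial (Fin 2) K) ∣ tangentCone (F s))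
    (u : ℕ)
    (hu : IsLeast {u' : ℕ | ∃ ℓ : ℕ,
      (tangentCone (F (t - 1))).coeff
        (Finsupp.single (0 : Fin 2) (2 ^ u') + Finsupp.single (1 : Fin 2) ℓ) ≠ 0} u)
    :
    tangentCone (F t) = (X 1 : MvPolynomial (Fin 2) K) ^ (2 ^ u - 2) := by
  have : CharP K 2 := charP_of_card_eq_prime_pow hcard
  replace h2pow : ∀ k, f.coeff (2 ^ k) = 0 := fun k => h2pow _ k rfl
  rw [eq_planarCurve] at hF0
  obtain ⟨t, rfl⟩ := Nat.exists_eq_add_of_le' ht1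
  rw [Nat.add_sub_cancel] at hu
  have hN := coeff_iterated_blowUp hnseq hFr
  set N : ℕ → ℕ := fun r => ∑ s ∈ Finset.range r, nseq (s + 1) with hNdef
  have hNsucc : ∀ r, N (r + 1) = N r + nseq (r + 1) := fun r => Finset.sum_range_succ _ _
  simp only [hF0] at hN
  change ∀ r, (∀ a b e, b + r * a = e + N r → _) ∧ (∀ a e, _ → r * a ≤ e + N r) ∧
    ∀ a b, _ → N r ≤ b + r * a at hN
  have htop := coeff_planarCurve_top (f := f) (κ := 0) hd3
  have hNle : ∀ r, N r ≤ d - 2 := fun r => by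
    have := (hN r).2.2 0 (d - 2) (by rw [htop]; exact one_ne_zero)
    omega
  have hcone : ∀ r a b, (tangentCone (F r)).coeff (planeExponent a b) =
      if a + b = nseq (r + 1) then (F r).coeff (planeExponent a b) else 0 := fun r =>
    coeff_tangentCone (hnseq (r + 1) (by omega))
  have hF : ∀ r a e, (F r).coeff (planeExponent a e) ≠ 0 → (a = 0 ∧ e + N r = d - 2) ∨
      ∃ i, 3 ≤ i ∧ i ≤ d ∧ 1 ≤ a ∧ a < i ∧ f.coeff i * shiftedChoose K i a ≠ 0 ∧
        d + r * a = e + N r + i := by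
    intro r a e h
    have h1 := (hN r).2.1 a e h
    rw [(hN r).1 a (e + N r - r * a) e (by omega)] at h
    obtain ⟨rfl, h2⟩ | ⟨i, k, h3, hid, hk1, hki, hne, rfl, h2⟩ :=
      eq_or_exists_of_coeff_planarCurve_ne_zero h
    · exact Or.inl ⟨rfl, by omega⟩
    · exact Or.inr ⟨i, h3, hid, hk1, hki, hne, by rw [Nat.sub_zero] at *; omega⟩
  have hNd : N (t + 2) = d - 2 := by
    rw [X_zero_dvd_iff] at ht
    push Not at ht
    obtain ⟨b, hb⟩ := ht
    rw [hcone] at hb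
    split_ifs at hb with h0
    · obtain ⟨-, h⟩ | ⟨i, -, -, h, -⟩ := hF _ _ _ hb
      · rw [hNsucc]
        omega
      · omega
    · exact absurd rfl hb
  have hD : N (t + 2) = N (t + 1) + nseq (t + 2) := hNsucc (t + 1)
  have hNlt : N (t + 1) < d - 2 := by
    refine lt_of_le_of_ne (hNle _) fun h => ?_
    have h1 := htleast t (by omega)
    rw [X_zero_dvd_iff] at h1
    have h2 := h1 (nseq (t + 1))
    rw [hcone, if_pos (zero_add _), (hN t).1 0 (d - 2) _ (by rw [← h, hNsucc]; omega), htop] at h2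
    exact one_ne_zero h2
  have hle : ∀ i k, 3 ≤ i → i ≤ d → 1 ≤ k → k < i → f.coeff i * shiftedChoose K i k ≠ 0 →
      i ≤ (t + 2) * k + 2 := by
    intro i k h3 hid hk hki hne
    rw [← coeff_planarCurve_of_mem (κ := 0) (by omega) h3 hid hk hki] at hne
    have := (hN (t + 2)).2.2 _ _ hne
    rw [Nat.sub_zero] at this
    omega
  have hlt : ∀ i k, 3 ≤ i → i ≤ d → 1 ≤ k → k < i → f.coeff i * shiftedChoose K i k ≠ 0 →
      i < (t + 2) * k + 2 := fun i k h3 hid hk hki hne =>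
    lt_of_le_of_ne (hle i k h3 hid hk hki hne) <|
      ne_mul_add_two_of_le hd hd3 hAd hdeg h2pow (fun ε hε => (hplanar ε hε).1) (by omega) hle h3
        hid hki hne
  obtain ⟨ℓ, hℓ⟩ := hu.1
  change (tangentCone (F t)).coeff (planeExponent (2 ^ u) ℓ) ≠ 0 at hℓ
  have hDu : nseq (t + 2) = 2 ^ u - 2 := by
    rw [hcone] at hℓ
    split_ifs at hℓ with hdegree
    · obtain ⟨h, -⟩ | ⟨i, h3, hid, hu1, hui, hne, hi⟩ := hF _ _ _ hℓ
      · exact absurd h (Nat.two_pow_pos u).ne'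
      · have hND := hNsucc t
        have hi' := hlt i _ h3 hid hu1 hui hne
        have hieq : i = (t + 1) * 2 ^ u + (nseq (t + 2) + 2) := by
          rw [Nat.succ_mul]
          omega
        obtain ⟨v, o, ho, hio⟩ := Nat.exists_eq_two_pow_mul_odd (by omega : i ≠ 0)
        have huv : u ≤ v := by
          by_contra! hvu
          have hpow : 2 * 2 ^ v ≤ 2 ^ u := by
            rw [← pow_succ']
            exact Nat.pow_le_pow_right two_pos hvu
          have h4 : f.coeff i * shiftedChoose K i (2 ^ v) ≠ 0 := by
            have h5 := shiftedChoose_two_pow (K := K) (v := v) ho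
            rw [← hio] at h5
            rw [h5, mul_one]
            exact left_ne_zero_of_mul hne
          have h6 := hle i _ h3 hid (Nat.two_pow_pos v) (by omega) h4
          have h7 := Nat.mul_le_mul_left (t + 1) hpow
          nlinarith
        have hdvd : 2 ^ u ∣ nseq (t + 2) + 2 := by
          have h7 : 2 ^ u ∣ i := hio ▸ (pow_dvd_pow 2 huv).mul_right o
          rw [hieq] at h7
          exact (Nat.dvd_add_right (Dvd.intro_left _ rfl)).1 h7
        obtain ⟨w, hw⟩ := hdvd
        have h9 : nseq (t + 2) < 2 ^ u := by
          have : (t + 2) * 2 ^ u = (t + 1) * 2 ^ u + 2 ^ u := by ring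
          omega
        obtain rfl | rfl | hw2 : w = 0 ∨ w = 1 ∨ 2 ≤ w := by omega
        · omega
        · omega
        · have : 2 ^ u * 2 ≤ 2 ^ u * w := Nat.mul_le_mul_left _ hw2
          obtain rfl | hu0 := Nat.eq_zero_or_pos u
          · omega
          · have := Nat.pow_le_pow_right two_pos hu0
            omega
    · exact absurd rfl hℓ
  rw [← hDu]
  have hcone' : ∀ a b, (tangentCone (F (t + 1))).coeff (planeExponent a b) =
      if a + b = nseq (t + 2) then (F (t + 1)).coeff (planeExponent a b) else 0 := hcone (t + 1)
  ext m
  rw [eq_planeExponent m, hcone', X_pow_eq_monomial, coeff_monomial,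
    show (Finsupp.single 1 (nseq (t + 2)) : Fin 2 →₀ ℕ) = planeExponent 0 (nseq (t + 2)) by
      simp [planeExponent]]
  generalize m 0 = a, m 1 = b
  simp only [planeExponent_inj]
  by_cases hab : 0 = a ∧ nseq (t + 2) = b
  · obtain ⟨rfl, rfl⟩ := hab
    rw [if_pos (zero_add _), if_pos ⟨rfl, rfl⟩, (hN (t + 1)).1 0 (d - 2) _ (by omega), htop]
  · rw [if_neg hab, ite_eq_right_iff]
    intro hsum
    by_contra hne
    obtain ⟨h, h'⟩ | ⟨i, h3, hid, ha1, hai, hne', hi⟩ := hF _ _ _ hne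
    · omega
    · have := hlt i _ h3 hid ha1 hai hne'
      have : (t + 2) * a = (t + 1) * a + a := by ring
      omega
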